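/- arXiv:1609.07575 — 3 statements merged into one kernel-verified Lean document; each statement's English description precedes it below -/
import Mathlib

section
/- Let k ≤ n be positive integers. The quotient ring R_{n,k} = ℚ[x_1, …, x_n]/I_{n,k} is a finite-dimensional ℚ-vector space whose dimension equals the number of surjections from {1, …, n} onto {1, …, k} (equivalently, k!·Stir(n,k), where Stir(n,k) is the Stirling number of the second kind). -/
open MvPolynomial

/-- The ideal `I_{n,k} ⊆ ℚ[x_1, …, x_n]` generated by `x_1^k, …, x_n^k` together with
the elementary symmetric polynomials `e_d(x_1, …, x_n)` for `n−k+1 ≤ d ≤ n`. -/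
noncomputable def Ink (n k : ℕ) : Ideal (MvPolynomial (Fin n) ℚ) :=
  Ideal.span ({p | ∃ i : Fin n, p = X i ^ k} ∪
    {p | ∃ d : ℕ, n - k + 1 ≤ d ∧ d ≤ n ∧ p = esymm (Fin n) ℚ d})

/-- The ideal generated by `x_1^k, …, x_n^k` and the elementary symmetric polynomials
`e_d(x_1, …, x_n)` with `d > n - s`. -/
noncomputable def powerEsymmIdeal (n k s : ℕ) : Ideal (MvPolynomial (Fin n) ℚ) :=
  Ideal.span ({p | ∃ i : Fin n, p = X i ^ k} ∪ {p | ∃ d : ℕ, n < d + s ∧ p = esymm (Fin n) ℚ d})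

lemma esymm_eq_zero_of_lt {n d : ℕ} (h : n < d) : esymm (Fin n) ℚ d = 0 := by
  rw [esymm, Finset.powersetCard_eq_empty.2 (by simpa using h), Finset.sum_empty]

lemma powerEsymmIdeal_self_le {n k : ℕ} (hkn : k ≤ n) : powerEsymmIdeal n k k ≤ Ink n k := by
  refine Ideal.span_le.2 ?_
  rintro p (⟨i, rfl⟩ | ⟨d, hd, rfl⟩)
  · exact Ideal.subset_span (Or.inl ⟨i, rfl⟩)
  · by_cases h : d ≤ n
    · exact Ideal.subset_span (Or.inr ⟨d, by omega, h, rfl⟩)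
    · rw [esymm_eq_zero_of_lt (by omega)]
      exact zero_mem _

lemma esymm_fin_succ (n d : ℕ) :
    esymm (Fin (n + 1)) ℚ (d + 1) =
      rename Fin.succ (esymm (Fin n) ℚ (d + 1)) + X 0 * rename Fin.succ (esymm (Fin n) ℚ d) := by
  have key (d : ℕ) : rename Fin.succ (esymm (Fin n) ℚ d) =
      (Finset.univ.val.map fun i : Fin n => (X i.succ : MvPolynomial (Fin (n + 1)) ℚ)).esymm d := by
    rw [rename_eq_aeval]
    exact aeval_esymm_eq_multiset_esymm (Fin n) ℚ d (X ∘ Fin.succ)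
  have huniv : (Finset.univ.val.map (X : Fin (n + 1) → MvPolynomial (Fin (n + 1)) ℚ)) =
      X 0 ::ₘ (Finset.univ.val.map fun i : Fin n => X i.succ) := by
    rw [Fin.univ_succ, Finset.cons_val, Multiset.map_cons, Finset.map_val, Multiset.map_map]
    rfl
  rw [key, key, esymm_eq_multiset_esymm, huniv]
  simp only [Multiset.esymm, Multiset.powersetCard_cons, Multiset.map_add, Multiset.sum_add,
    Multiset.map_map, Function.comp_def, Multiset.prod_cons, Multiset.sum_map_mul_left]

lemma isHomogeneous_esymm (n d : ℕ) : (esymm (Fin n) ℚ d).IsHomogeneous d := by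
  refine IsHomogeneous.sum _ _ _ fun t ht => ?_
  rw [← (Finset.mem_powersetCard.1 ht).2, Finset.card_eq_sum_ones]
  exact IsHomogeneous.prod _ _ _ fun i _ => isHomogeneous_X ℚ i

lemma X_zero_pow_mul_rename_esymm_mem {n k s : ℕ} (t : ℕ) :
    ∀ d, n < d + s → n < d + t →
      X 0 ^ t * rename Fin.succ (esymm (Fin n) ℚ d) ∈ powerEsymmIdeal (n + 1) k s := by
  induction t with
  | zero =>
    intro d _ hd
    rw [esymm_eq_zero_of_lt (by omega), map_zero, mul_zero]
    exact zero_mem _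
  | succ t ih =>
    intro d hds hdt
    have h₁ : esymm (Fin (n + 1)) ℚ (d + 1) ∈ powerEsymmIdeal (n + 1) k s :=
      Ideal.subset_span (Or.inr ⟨d + 1, by omega, rfl⟩)
    have h₂ := ih (d + 1) (by omega) (by omega)
    have h₃ : X 0 ^ (t + 1) * rename Fin.succ (esymm (Fin n) ℚ d) =
        X 0 ^ t * esymm (Fin (n + 1)) ℚ (d + 1) -
          X 0 ^ t * rename Fin.succ (esymm (Fin n) ℚ (d + 1)) := by
      rw [esymm_fin_succ]
      ring
    rw [h₃]
    exact sub_mem (Ideal.mul_mem_left _ _ h₁) h₂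

lemma X_zero_pow_mul_rename_mem {n k s s' i : ℕ} (hs : i < s ∧ s = s' + 1 ∨ s ≤ i ∧ s = s')
    {r : MvPolynomial (Fin n) ℚ} (hr : r ∈ powerEsymmIdeal n k s') :
    X 0 ^ i * rename Fin.succ r ∈
      powerEsymmIdeal (n + 1) k s ⊔ Ideal.span {(X 0 : MvPolynomial (Fin (n + 1)) ℚ) ^ (i + 1)} := by
  induction hr using Submodule.span_induction with
  | zero => simp
  | add x y _ _ hx hy =>
    rw [map_add, mul_add]
    exact add_mem hx hy
  | smul a x _ hx =>
    rw [smul_eq_mul, map_mul, mul_left_comm]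
    exact Ideal.mul_mem_left _ _ hx
  | mem x hx =>
    rcases hx with ⟨j, rfl⟩ | ⟨d, hd, rfl⟩
    · refine Ideal.mul_mem_left _ _ (Ideal.mem_sup_left (Ideal.subset_span (Or.inl ⟨j.succ, ?_⟩)))
      simp
    · rcases hs with ⟨_, rfl⟩ | ⟨hsi, rfl⟩
      · rcases d with _ | d
        · refine Ideal.mul_mem_left _ _ (Ideal.mem_sup_left (Ideal.subset_span
            (Or.inr ⟨0, by omega, ?_⟩)))
          simp
        · have h₁ : X 0 ^ i * rename Fin.succ (esymm (Fin n) ℚ (d + 1)) =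
              X 0 ^ i * esymm (Fin (n + 1)) ℚ (d + 1) +
                -rename Fin.succ (esymm (Fin n) ℚ d) * X 0 ^ (i + 1) := by
            rw [esymm_fin_succ]
            ring
          rw [h₁]
          refine Submodule.add_mem_sup (Ideal.mul_mem_left _ _ (Ideal.subset_span
            (Or.inr ⟨d + 1, by omega, rfl⟩)))
            (Ideal.mul_mem_left _ _ (Ideal.mem_span_singleton_self _))
      · obtain ⟨j, rfl⟩ := Nat.exists_eq_add_of_le' hsi
        rw [pow_add (X 0 : MvPolynomial (Fin (n + 1)) ℚ) j s, mul_assoc]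
        exact Ideal.mul_mem_left _ _
          (Ideal.mem_sup_left (X_zero_pow_mul_rename_esymm_mem s d hd hd))

lemma exists_eq_rename_succ_add_X_zero_mul {n : ℕ} (q : MvPolynomial (Fin (n + 1)) ℚ) :
    ∃ p q', q = rename Fin.succ p + X 0 * q' := by
  induction q using MvPolynomial.induction_on with
  | C a => exact ⟨C a, 0, by simp⟩
  | add p q hp hq =>
    obtain ⟨a, b, rfl⟩ := hp
    obtain ⟨c, d, rfl⟩ := hq
    exact ⟨a + c, b + d, by rw [map_add]; ring⟩
  | mul_X p i hp =>
    refine Fin.cases ⟨0, p, by simp [mul_comm]⟩ (fun j => ?_) i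
    obtain ⟨a, b, rfl⟩ := hp
    exact ⟨a * X j, b * X j.succ, by rw [map_mul, rename_X]; ring⟩

lemma exists_perm_mem_iff_lt_card {k : ℕ} (S : Finset (Fin k)) :
    ∃ e : Equiv.Perm (Fin k), ∀ i, e i ∈ S ↔ (i : ℕ) < S.card := by
  have hle : S.card ≤ k := by simpa using S.card_le_univ
  have hcard : Fintype.card {i : Fin k // (i : ℕ) < S.card} = Fintype.card {j // j ∈ S} := by
    rw [Fintype.card_subtype, Fintype.card_coe, Fin.card_filter_val_lt, min_eq_right hle]
  let e := Fintype.equivOfCardEq hcard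
  exact ⟨e.extendSubtype, fun i => ⟨fun h => by_contra fun hi => e.extendSubtype_not_mem i hi h,
    e.extendSubtype_mem i⟩⟩

/-- Polynomials indexed by the maps `Fin n → Fin k` whose image contains `S` span the quotient by
`powerEsymmIdeal n k S.card`. -/
lemma exists_spanning_family (n k : ℕ) : ∀ S : Finset (Fin k),
    ∃ b : (Fin n → Fin k) → MvPolynomial (Fin n) ℚ,
      Submodule.span ℚ (b '' {f | ↑S ⊆ Set.range f}) ⊔
        (powerEsymmIdeal n k S.card).restrictScalars ℚ = ⊤ := by
  induction n with
  | zero =>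
    intro S
    refine ⟨fun _ => 1, eq_top_iff.2 fun p _ => ?_⟩
    rcases S.eq_empty_or_nonempty with rfl | hS
    · refine Submodule.mem_sup_left ?_
      obtain ⟨c, rfl⟩ := C_surjective (Fin 0) p
      rw [← mul_one (C c), ← smul_eq_C_mul]
      exact Submodule.smul_mem _ _ (Submodule.subset_span ⟨Fin.elim0, by simp, rfl⟩)
    · refine Submodule.mem_sup_right ?_
      have h₁ : (1 : MvPolynomial (Fin 0) ℚ) ∈ powerEsymmIdeal 0 k S.card :=
        Ideal.subset_span (Or.inr ⟨0, by simpa using hS.card_pos, by simp⟩)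
      rw [(Ideal.eq_top_iff_one _).2 h₁]
      trivial
  | succ n ih =>
    choose b hb using ih
    intro S
    obtain ⟨e, he⟩ := exists_perm_mem_iff_lt_card S
    refine ⟨fun f => X 0 ^ (e.symm (f 0) : ℕ) * rename Fin.succ (b (S.erase (f 0)) (Fin.tail f)), ?_⟩
    set N := Submodule.span ℚ ((fun f : Fin (n + 1) → Fin k =>
      X 0 ^ (e.symm (f 0) : ℕ) * rename Fin.succ (b (S.erase (f 0)) (Fin.tail f))) ''
        {f | ↑S ⊆ Set.range f}) ⊔ (powerEsymmIdeal (n + 1) k S.card).restrictScalars ℚ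
    have hideal {p} (hp : p ∈ powerEsymmIdeal (n + 1) k S.card) : p ∈ N :=
      Submodule.mem_sup_right hp
    have hstep (t : ℕ) : ∀ i, k ≤ i + t → ∀ q, X 0 ^ i * q ∈ N := by
      induction t with
      | zero =>
        intro i hi q
        refine hideal (Ideal.mul_mem_right _ _ ?_)
        exact Ideal.pow_mem_of_pow_mem _ (Ideal.subset_span (Or.inl ⟨0, rfl⟩)) hi
      | succ t iht =>
        intro i hi q
        by_cases hik : k ≤ i
        · exact iht i (by omega) q
        have hnext := iht (i + 1) (by omega)
        obtain ⟨p, q', rfl⟩ := exists_eq_rename_succ_add_X_zero_mul q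
        rw [mul_add, ← mul_assoc, ← pow_succ]
        refine add_mem ?_ (hnext q')
        set j := e ⟨i, by omega⟩ with hj
        obtain ⟨c, hc, r, hr, rfl⟩ := Submodule.mem_sup.1
          ((hb (S.erase j)).symm ▸ Submodule.mem_top (x := p))
        rw [map_add, mul_add]
        refine add_mem ?_ ?_
        · induction hc using Submodule.span_induction with
          | zero => simp
          | add x y _ _ hx hy =>
            rw [map_add, mul_add]
            exact add_mem hx hy
          | smul a x _ hx =>
            rw [map_smul, mul_smul_comm]
            exact Submodule.smul_mem _ _ hx
          | mem x hx =>
            obtain ⟨g, hg, rfl⟩ := hx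
            refine Submodule.mem_sup_left (Submodule.subset_span ⟨Fin.cons j g, ?_, ?_⟩)
            · intro l hl
              by_cases hlj : l = j
              · exact ⟨0, by simp [hlj]⟩
              · obtain ⟨m, rfl⟩ := hg (Finset.mem_coe.2 (Finset.mem_erase.2 ⟨hlj, hl⟩))
                exact ⟨m.succ, by simp⟩
            · simp [hj]
        · have hs : i < S.card ∧ S.card = (S.erase j).card + 1 ∨
              S.card ≤ i ∧ S.card = (S.erase j).card := by
            by_cases hjS : j ∈ S
            · exact Or.inl ⟨(he _).1 hjS, (Finset.card_erase_add_one hjS).symm⟩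
            · exact Or.inr ⟨not_lt.1 fun h => hjS ((he _).2 h),
                by rw [Finset.erase_eq_of_notMem hjS]⟩
          obtain ⟨u, hu, v, hv, huv⟩ := Submodule.mem_sup.1 (X_zero_pow_mul_rename_mem hs hr)
          obtain ⟨w, rfl⟩ := Ideal.mem_span_singleton.1 hv
          rw [← huv]
          exact add_mem (hideal hu) (hnext w)
    refine eq_top_iff.2 fun q _ => ?_
    simpa using hstep k 0 (by omega) q

lemma exists_spanning_family_Ink {n k : ℕ} (hkn : k ≤ n) :
    ∃ b : {f : Fin n → Fin k // Function.Surjective f} → MvPolynomial (Fin n) ℚ ⧸ Ink n k,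
      Submodule.span ℚ (Set.range b) = ⊤ := by
  obtain ⟨b, hb⟩ := exists_spanning_family n k Finset.univ
  refine ⟨fun f => Ideal.Quotient.mkₐ ℚ _ (b f), eq_top_iff.2 fun y _ => ?_⟩
  obtain ⟨p, rfl⟩ := Ideal.Quotient.mkₐ_surjective ℚ _ y
  obtain ⟨c, hc, r, hr, rfl⟩ := Submodule.mem_sup.1 (hb.symm ▸ Submodule.mem_top (x := p))
  have hr' : r ∈ Ink n k := powerEsymmIdeal_self_le hkn (by simpa using hr)
  have hr₀ : Ideal.Quotient.mkₐ ℚ (Ink n k) r = 0 := Ideal.Quotient.eq_zero_iff_mem.2 hr'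
  rw [map_add, hr₀, add_zero]
  have hmap := Submodule.mem_map_of_mem (f := (Ideal.Quotient.mkₐ ℚ (Ink n k)).toLinearMap) hc
  rw [Submodule.map_span] at hmap
  refine Submodule.span_mono ?_ hmap
  rintro _ ⟨_, ⟨f, hf, rfl⟩, rfl⟩
  exact ⟨⟨f, fun j => hf (by simp)⟩, rfl⟩

section LowerDegreeImage

variable {σ A : Type*} [CommRing A] [Algebra ℚ A] (ev : MvPolynomial σ ℚ →ₐ[ℚ] A)

/-- The image under `ev` of the polynomials of degree less than `D`. -/
noncomputable def lowerDegreeImage (D : ℕ) : Submodule ℚ A :=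
  Submodule.span ℚ (ev '' {p | ∃ d < D, p.IsHomogeneous d})

variable {ev}

lemma mul_mem_lowerDegreeImage {p : MvPolynomial σ ℚ} {e D : ℕ} (hp : p.IsHomogeneous e) {w : A}
    (hw : w ∈ lowerDegreeImage ev D) : ev p * w ∈ lowerDegreeImage ev (e + D) := by
  induction hw using Submodule.span_induction with
  | zero => simp
  | add x y _ _ hx hy =>
    rw [mul_add]
    exact add_mem hx hy
  | smul a x _ hx =>
    rw [mul_smul_comm]
    exact Submodule.smul_mem _ _ hx
  | mem x hx =>
    obtain ⟨q, ⟨d, hd, hq⟩, rfl⟩ := hx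
    exact Submodule.subset_span ⟨p * q, ⟨e + d, by omega, hp.mul hq⟩, map_mul _ _ _⟩

lemma homogeneousComponent_mul_of_isHomogeneous {a r : MvPolynomial σ ℚ} {i : ℕ}
    (ha : a.IsHomogeneous i) (D : ℕ) :
    homogeneousComponent D (a * r) =
      if i ≤ D then a * homogeneousComponent (D - i) r else 0 := by
  let _ := MvPolynomial.gradedAlgebra (σ := σ) (R := ℚ)
  rw [← decomposition.decompose'_apply, ← decomposition.decompose'_apply]
  exact DirectSum.coe_decompose_mul_of_left_mem (homogeneousSubmodule σ ℚ) D ha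

lemma map_homogeneousComponent_mem_lowerDegreeImage {G : Set (MvPolynomial σ ℚ)}
    (hG : ∀ g ∈ G, ∃ d, g.IsHomogeneous d ∧ ev g ∈ lowerDegreeImage ev d) {r : MvPolynomial σ ℚ}
    (hr : r ∈ Ideal.span G) (D : ℕ) :
    ev (homogeneousComponent D r) ∈ lowerDegreeImage ev D := by
  induction hr using Submodule.span_induction generalizing D with
  | zero => simp
  | add x y _ _ hx hy =>
    rw [map_add, map_add]
    exact add_mem (hx D) (hy D)
  | smul a x _ hx =>
    rw [smul_eq_mul, ← sum_homogeneousComponent a, Finset.sum_mul, map_sum, map_sum]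
    refine Submodule.sum_mem _ fun i _ => ?_
    rw [homogeneousComponent_mul_of_isHomogeneous (homogeneousComponent_isHomogeneous i a)]
    split_ifs with hi
    · rw [map_mul]
      simpa [Nat.add_sub_cancel' hi] using
        mul_mem_lowerDegreeImage (homogeneousComponent_isHomogeneous i a) (hx (D - i))
    · simp
  | mem x hx =>
    obtain ⟨d, hd, hev⟩ := hG x hx
    rw [homogeneousComponent_of_mem hd]
    split_ifs with h
    · exact h ▸ hev
    · simp

/-- Homogeneous polynomials spanning modulo `I` are sent by a surjection `ev` to a spanning set, if
`ev` sends each generator of `I` to the image of a polynomial of smaller degree. -/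
lemma span_image_eq_top_of_homogeneous (hev : Function.Surjective ev)
    {G B : Set (MvPolynomial σ ℚ)}
    (hG : ∀ g ∈ G, ∃ d, g.IsHomogeneous d ∧ ev g ∈ lowerDegreeImage ev d)
    (hB : ∀ b ∈ B, ∃ d, b.IsHomogeneous d)
    (htop : Submodule.span ℚ B ⊔ (Ideal.span G).restrictScalars ℚ = ⊤) :
    Submodule.span ℚ (ev '' B) = ⊤ := by
  have hcomp (d : ℕ) {c} (hc : c ∈ Submodule.span ℚ B) :
      homogeneousComponent d c ∈ Submodule.span ℚ B := by
    induction hc using Submodule.span_induction with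
    | zero => simp
    | add x y _ _ hx hy =>
      rw [map_add]
      exact add_mem hx hy
    | smul a x _ hx =>
      rw [map_smul]
      exact Submodule.smul_mem _ _ hx
    | mem x hx =>
      obtain ⟨e, he⟩ := hB x hx
      rw [homogeneousComponent_of_mem he]
      split_ifs
      · exact Submodule.subset_span hx
      · exact zero_mem _
  have hmap {c} (hc : c ∈ Submodule.span ℚ B) : ev c ∈ Submodule.span ℚ (ev '' B) := by
    have := Submodule.mem_map_of_mem (f := ev.toLinearMap) hc
    rwa [Submodule.map_span] at this
  have hle (D : ℕ) : lowerDegreeImage ev D ≤ Submodule.span ℚ (ev '' B) := by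
    induction D with
    | zero => simp [lowerDegreeImage]
    | succ D ih =>
      refine Submodule.span_le.2 ?_
      rintro _ ⟨p, ⟨d, hd, hp⟩, rfl⟩
      obtain ⟨c, hc, r, hr, hcr⟩ := Submodule.mem_sup.1 (htop.symm ▸ Submodule.mem_top (x := p))
      have hlow : lowerDegreeImage ev d ≤ lowerDegreeImage ev D :=
        Submodule.span_mono (Set.image_mono fun q ⟨e, he, hq⟩ => ⟨e, by omega, hq⟩)
      rw [SetLike.mem_coe, ← homogeneousComponent_eq_self hp, ← hcr, map_add, map_add]
      exact add_mem (hmap (hcomp d hc))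
        (ih (hlow (map_homogeneousComponent_mem_lowerDegreeImage hG (by simpa using hr) d)))
  refine eq_top_iff.2 fun y _ => ?_
  obtain ⟨p, rfl⟩ := hev y
  rw [← sum_homogeneousComponent p, map_sum]
  exact Submodule.sum_mem _ fun i _ => hle (i + 1)
    (Submodule.subset_span ⟨_, ⟨i, by omega, homogeneousComponent_isHomogeneous i p⟩, rfl⟩)

lemma finrank_le_finrank_quotient_span (hev : Function.Surjective ev)
    {G : Set (MvPolynomial σ ℚ)}
    (hG : ∀ g ∈ G, ∃ d, g.IsHomogeneous d ∧ ev g ∈ lowerDegreeImage ev d)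
    [FiniteDimensional ℚ (MvPolynomial σ ℚ ⧸ Ideal.span G)] :
    Module.finrank ℚ A ≤ Module.finrank ℚ (MvPolynomial σ ℚ ⧸ Ideal.span G) := by
  set π := (Ideal.Quotient.mkₐ ℚ (Ideal.span G)).toLinearMap
  have hspan : ⊤ ≤ Submodule.span ℚ (Set.range fun m : σ →₀ ℕ => π (monomial m 1)) := by
    have h := (basisMonomials σ ℚ).span_eq
    rw [Set.range_comp' π, ← Submodule.map_span]
    rw [coe_basisMonomials] at h
    rw [h, Submodule.map_top, LinearMap.range_eq_top.2 (Ideal.Quotient.mkₐ_surjective ℚ _)]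
  let v := Module.Basis.ofSpan hspan
  have hv (i) : ∃ m : σ →₀ ℕ, π (monomial m 1) = v i := Module.Basis.ofSpan_subset hspan ⟨i, rfl⟩
  choose m hm using hv
  have := Module.Finite.finite_basis v
  have := Fintype.ofFinite ((linearIndepOn_empty ℚ (id : MvPolynomial σ ℚ ⧸ Ideal.span G → _)).extend
    (Set.empty_subset (Set.range fun m : σ →₀ ℕ => π (monomial m 1))))
  have htop := span_image_eq_top_of_homogeneous hev hG
    (B := Set.range fun i => monomial (m i) (1 : ℚ)) (by
      rintro _ ⟨i, rfl⟩
      exact ⟨_, isHomogeneous_monomial _ rfl⟩) (by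
      refine eq_top_iff.2 fun p _ => ?_
      have hp : π p ∈ Submodule.map π
          (Submodule.span ℚ (Set.range fun i => monomial (m i) (1 : ℚ))) := by
        rw [Submodule.map_span, ← Set.range_comp]
        have : (π ∘ fun i => monomial (m i) (1 : ℚ)) = v := funext hm
        rw [this, v.span_eq]
        trivial
      obtain ⟨c, hc, hcp⟩ := hp
      refine Submodule.mem_sup.2 ⟨c, hc, p - c, ?_, by ring⟩
      exact Ideal.Quotient.eq.1 hcp.symm)
  rw [← Set.range_comp] at htop
  rw [Module.finrank_eq_card_basis v, ← finrank_top ℚ A, ← htop]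
  exact finrank_range_le_card _

end LowerDegreeImage

section SurjectionPoints

variable (n k : ℕ)

/-- Evaluation of polynomials at the points `(f 1, …, f n)`, for surjections `f`. -/
noncomputable def evalSurjections :
    MvPolynomial (Fin n) ℚ →ₐ[ℚ] ({f : Fin n → Fin k // Function.Surjective f} → ℚ) :=
  aeval fun i f => ((f.1 i : ℕ) : ℚ)

variable {n k}

lemma evalSurjections_apply (p : MvPolynomial (Fin n) ℚ)
    (f : {f : Fin n → Fin k // Function.Surjective f}) :
    evalSurjections n k p f = aeval (fun i => ((f.1 i : ℕ) : ℚ)) p := by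
  have h : (Pi.evalAlgHom ℚ (fun _ => ℚ) f).comp (evalSurjections n k) =
      aeval (fun i => ((f.1 i : ℕ) : ℚ)) := by
    ext i
    simp [evalSurjections]
  exact DFunLike.congr_fun h p

lemma evalSurjections_surjective : Function.Surjective (evalSurjections n k) := by
  classical
  rw [← AlgHom.coe_toLinearMap, ← LinearMap.range_eq_top, eq_top_iff, ← (Pi.basisFun ℚ _).span_eq,
    Submodule.span_le]
  rintro _ ⟨f, rfl⟩
  let p : MvPolynomial (Fin n) ℚ :=
    ∏ i, ∏ j ∈ Finset.univ.erase (f.1 i), (X i - C ((j : ℕ) : ℚ))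
  have hp (g) : evalSurjections n k p g =
      ∏ i, ∏ j ∈ Finset.univ.erase (f.1 i), (((g.1 i : ℕ) : ℚ) - ((j : ℕ) : ℚ)) := by
    simp [evalSurjections_apply, p]
  have hne : evalSurjections n k p f ≠ 0 := by
    rw [hp]
    refine Finset.prod_ne_zero_iff.2 fun i _ => Finset.prod_ne_zero_iff.2 fun j hj h => ?_
    exact (Finset.mem_erase.1 hj).1 (Fin.ext (by exact_mod_cast (sub_eq_zero.1 h).symm))
  refine ⟨(evalSurjections n k p f)⁻¹ • p, ?_⟩
  rw [map_smul, AlgHom.coe_toLinearMap]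
  funext g
  by_cases hfg : g = f
  · subst hfg
    simp [hne]
  · obtain ⟨i, hi⟩ : ∃ i, g.1 i ≠ f.1 i := by
      by_contra! h
      exact hfg (Subtype.ext (funext h))
    have hzero : evalSurjections n k p g = 0 := by
      rw [hp]
      exact Finset.prod_eq_zero (Finset.mem_univ i)
        (Finset.prod_eq_zero (Finset.mem_erase.2 ⟨hi, Finset.mem_univ _⟩) (sub_self _))
    simp [hzero, hfg]

lemma evalSurjections_X_pow_mem (i : Fin n) :
    evalSurjections n k (X i ^ k) ∈ lowerDegreeImage (evalSurjections n k) k := by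
  let P : Polynomial ℚ := ∏ j : Fin k, (Polynomial.X - Polynomial.C ((j : ℕ) : ℚ))
  have hmonic : P.Monic := Polynomial.monic_prod_X_sub_C _ _
  have hdeg : P.natDegree = k := by
    rw [Polynomial.natDegree_finsetProd_X_sub_C_eq_card]
    simp
  have heq : evalSurjections n k (X i ^ k) =
      -∑ b ∈ Finset.range k, P.coeff b • evalSurjections n k (X i ^ b) := by
    funext f
    have hroot : P.eval ((f.1 i : ℕ) : ℚ) = 0 := by
      rw [Polynomial.eval_prod]
      exact Finset.prod_eq_zero (Finset.mem_univ (f.1 i)) (by simp)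
    rw [hmonic.as_sum, hdeg] at hroot
    simp only [Polynomial.eval_add, Polynomial.eval_pow, Polynomial.eval_X,
      Polynomial.eval_finsetSum, Polynomial.eval_mul, Polynomial.eval_C] at hroot
    simpa [evalSurjections_apply] using eq_neg_of_add_eq_zero_left hroot
  rw [heq]
  refine neg_mem (Submodule.sum_mem _ fun b hb => Submodule.smul_mem _ _ (Submodule.subset_span ?_))
  exact ⟨X i ^ b, ⟨b, Finset.mem_range.1 hb, isHomogeneous_X_pow i b⟩, rfl⟩

lemma prod_dvd_prod_of_surjective {f : Fin n → Fin k} (hf : Function.Surjective f) :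
    (∏ j : Fin k, (Polynomial.X + Polynomial.C ((j : ℕ) : ℚ))) ∣
      ∏ i, (Polynomial.X + Polynomial.C ((f i : ℕ) : ℚ)) := by
  classical
  obtain ⟨g, hg⟩ := hf.hasRightInverse
  have h : (∏ j : Fin k, (Polynomial.X + Polynomial.C ((j : ℕ) : ℚ))) =
      ∏ i ∈ Finset.univ.image g, (Polynomial.X + Polynomial.C ((f i : ℕ) : ℚ)) := by
    rw [Finset.prod_image fun a _ b _ hab => hg.injective hab]
    simp [hg _]
  rw [h]
  exact Finset.prod_dvd_prod_of_subset _ _ _ (Finset.subset_univ _)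

lemma evalSurjections_esymm_mem {d : ℕ} (hdn : d ≤ n) (hd : n < d + k) :
    evalSurjections n k (esymm (Fin n) ℚ d) ∈ lowerDegreeImage (evalSurjections n k) d := by
  let P : Polynomial ℚ := ∏ j : Fin k, (Polynomial.X + Polynomial.C ((j : ℕ) : ℚ))
  have hmonic : P.Monic := Polynomial.monic_prod_of_monic _ _ fun j _ => Polynomial.monic_X_add_C _
  have hdeg : P.degree = k := by
    simp only [P, Polynomial.degree_prod, Polynomial.degree_X_add_C]
    simp
  let c (j : ℕ) : ℚ := ((Polynomial.X ^ (n - j) : Polynomial ℚ) %ₘ P).coeff (n - d)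
  have hc (j : ℕ) (hj : n < j + k) (hjn : j ≤ n) : c j = if j = d then 1 else 0 := by
    have h : (Polynomial.X ^ (n - j) : Polynomial ℚ) %ₘ P = Polynomial.X ^ (n - j) := by
      rw [Polynomial.modByMonic_eq_self_iff hmonic, hdeg, Polynomial.degree_X_pow]
      exact_mod_cast (by omega : n - j < k)
    simp only [c, h, Polynomial.coeff_X_pow]
    exact if_congr (by omega) rfl rfl
  have hsum : ∑ j ∈ Finset.range (n + 1), c j • evalSurjections n k (esymm (Fin n) ℚ j) = 0 := by
    funext f
    have hdvd := (Polynomial.modByMonic_eq_zero_iff_dvd hmonic).2 (prod_dvd_prod_of_surjective f.2)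
    have hprod := Multiset.prod_X_add_C_eq_sum_esymm
      (Finset.univ.val.map fun i => ((f.1 i : ℕ) : ℚ))
    rw [Multiset.map_map] at hprod
    change ∏ i, (Polynomial.X + Polynomial.C ((f.1 i : ℕ) : ℚ)) = _ at hprod
    rw [hprod] at hdvd
    have hcoeff := congrArg (fun q => Polynomial.coeff q (n - d)) hdvd
    simp only [← Polynomial.smul_eq_C_mul] at hcoeff
    change (Polynomial.modByMonicHom P _).coeff _ = _ at hcoeff
    rw [map_sum, Polynomial.finsetSum_coeff] at hcoeff
    simp only [map_smul, Polynomial.coeff_smul] at hcoeff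
    simp only [Finset.sum_apply, Pi.smul_apply, evalSurjections_apply,
      aeval_esymm_eq_multiset_esymm, smul_eq_mul, Pi.zero_apply]
    simpa [c, mul_comm, Polynomial.modByMonicHom] using hcoeff
  rw [← Finset.add_sum_erase _ _ (Finset.mem_range.2 (by omega : d < n + 1)), hc d hd hdn,
    if_pos rfl, one_smul] at hsum
  rw [eq_neg_of_add_eq_zero_left hsum]
  refine neg_mem (Submodule.sum_mem _ fun j hj => ?_)
  obtain ⟨hjd, hj⟩ := Finset.mem_erase.1 hj
  rw [Finset.mem_range] at hj
  by_cases hlt : j < d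
  · exact Submodule.smul_mem _ _
      (Submodule.subset_span ⟨_, ⟨j, hlt, isHomogeneous_esymm n _⟩, rfl⟩)
  · rw [hc j (by omega) (by omega), if_neg hjd, zero_smul]
    exact zero_mem _

end SurjectionPoints

theorem stmt5 (n k : ℕ) (hk : 1 ≤ k) (hkn : k ≤ n) :
    FiniteDimensional ℚ (MvPolynomial (Fin n) ℚ ⧸ Ink n k) ∧
    Module.finrank ℚ (MvPolynomial (Fin n) ℚ ⧸ Ink n k)
      = Nat.card {f : Fin n → Fin k // Function.Surjective f} := by
  classical
  obtain ⟨b, hb⟩ := exists_spanning_family_Ink hkn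
  have hfin : FiniteDimensional ℚ (MvPolynomial (Fin n) ℚ ⧸ Ink n k) :=
    ⟨⟨(Set.finite_range b).toFinset, by simpa using hb⟩⟩
  refine ⟨hfin, le_antisymm ?_ ?_⟩
  · rw [← finrank_top ℚ (MvPolynomial (Fin n) ℚ ⧸ Ink n k), ← hb, Nat.card_eq_fintype_card]
    exact finrank_range_le_card b
  · rw [Nat.card_eq_fintype_card, ← Module.finrank_fintype_fun_eq_card ℚ]
    unfold Ink at hfin ⊢
    refine finrank_le_finrank_quotient_span evalSurjections_surjective ?_
    rintro _ (⟨i, rfl⟩ | ⟨d, hd, hdn, rfl⟩)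
    · exact ⟨k, isHomogeneous_X_pow i k, evalSurjections_X_pow_mem i⟩
    · exact ⟨d, isHomogeneous_esymm n _, evalSurjections_esymm_mem hdn (by omega)⟩
end

section
/- Let k ≤ n be positive integers. Then I_{n,k} = T(Y_{n,k}); that is, the ideal generated by the top-degree homogeneous components of the polynomials vanishing on Y_{n,k} equals I_{n,k}. -/
open MvPolynomial

/-- `T(Y_{n,k})`: the ideal generated by top-degree homogeneous components `τ(f)` of the
nonzero polynomials `f` vanishing on the set `Y_{n,k}` of points `y ∈ ℚ^n` whose set of
coordinates is exactly `{α_1, …, α_k}`. -/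
noncomputable def topIdeal (n k : ℕ) (α : Fin k → ℚ) : Ideal (MvPolynomial (Fin n) ℚ) :=
  Ideal.span {g | ∃ f : MvPolynomial (Fin n) ℚ, f ≠ 0 ∧
    (∀ y : Fin n → ℚ, Set.range y = Set.range α → eval y f = 0) ∧
    g = homogeneousComponent f.totalDegree f}

namespace MvPolynomial

section TopForm

variable {σ R K : Type*} [CommRing R] [Field K]

theorem homogeneousComponent_X_mul_succ (d : ℕ) (i : σ) (p : MvPolynomial σ R) :
    homogeneousComponent (d + 1) (X i * p) = X i * homogeneousComponent d p := by
  classical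
  ext m
  rw [coeff_homogeneousComponent, coeff_X_mul', coeff_X_mul', coeff_homogeneousComponent]
  by_cases hi : i ∈ m.support
  · have h1 : Finsupp.single i 1 ≤ m := by
      simpa [Nat.one_le_iff_ne_zero] using hi
    have h2 : m.degree = (m - Finsupp.single i 1).degree + 1 := by
      conv_lhs => rw [← tsub_add_cancel_of_le h1]
      simp
    simp [hi, h2]
  · simp [hi]

theorem homogeneousComponent_X_mul_zero (i : σ) (p : MvPolynomial σ R) :
    homogeneousComponent 0 (X i * p) = 0 := by
  simp [homogeneousComponent_zero, ← constantCoeff_eq]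

/-- The ideal of polynomials all of whose homogeneous components are top degree forms (or zero)
of elements of the ideal `N`. -/
def topFormIdeal (N : Ideal (MvPolynomial σ R)) : Ideal (MvPolynomial σ R) where
  carrier := {q | ∀ d, ∃ f ∈ N, (∀ e, d < e → homogeneousComponent e f = 0) ∧
    homogeneousComponent d f = homogeneousComponent d q}
  zero_mem' d := ⟨0, N.zero_mem, by simp, by simp⟩
  add_mem' {p q} hp hq d := by
    obtain ⟨f, hf, hf1, hf2⟩ := hp d
    obtain ⟨g, hg, hg1, hg2⟩ := hq d
    refine ⟨f + g, N.add_mem hf hg, fun e he => ?_, ?_⟩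
    · simp [hf1 e he, hg1 e he]
    · simp [hf2, hg2]
  smul_mem' c q hq := by
    induction c using MvPolynomial.induction_on generalizing q with
    | C a =>
      intro d
      obtain ⟨f, hf, hf1, hf2⟩ := hq d
      refine ⟨C a * f, N.mul_mem_left _ hf, fun e he => ?_, ?_⟩
      · simp [homogeneousComponent_C_mul, hf1 e he]
      · simp [homogeneousComponent_C_mul, hf2]
    | add a b ha hb =>
      intro d
      obtain ⟨f, hf, hf1, hf2⟩ := ha q hq d
      obtain ⟨g, hg, hg1, hg2⟩ := hb q hq d
      refine ⟨f + g, N.add_mem hf hg, fun e he => ?_, ?_⟩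
      · simp [hf1 e he, hg1 e he]
      · rw [map_add, hf2, hg2, ← map_add, ← add_smul]
    | mul_X a i ha =>
      rw [mul_smul]
      refine ha _ fun d => ?_
      cases d with
      | zero =>
        exact ⟨0, N.zero_mem, by simp,
          by rw [map_zero, smul_eq_mul, homogeneousComponent_X_mul_zero]⟩
      | succ d =>
        obtain ⟨f, hf, hf1, hf2⟩ := hq d
        refine ⟨X i * f, N.mul_mem_left _ hf, fun e he => ?_, ?_⟩
        · obtain ⟨e, rfl⟩ : ∃ e', e = e' + 1 := ⟨e - 1, by omega⟩
          rw [homogeneousComponent_X_mul_succ, hf1 e (by omega), mul_zero]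
        · rw [smul_eq_mul, homogeneousComponent_X_mul_succ, homogeneousComponent_X_mul_succ, hf2]

theorem homogeneousComponent_homogeneousComponent_of_ne {d e : ℕ} (h : e ≠ d)
    (p : MvPolynomial σ R) : homogeneousComponent e (homogeneousComponent d p) = 0 := by
  rw [homogeneousComponent_of_mem (homogeneousComponent_mem d p), if_neg h]

theorem homogeneousComponent_homogeneousComponent_self (d : ℕ) (p : MvPolynomial σ R) :
    homogeneousComponent d (homogeneousComponent d p) = homogeneousComponent d p :=
  homogeneousComponent_eq_self (homogeneousComponent_isHomogeneous d p)

theorem eq_zero_of_homogeneousComponent_eq_zero {f : MvPolynomial σ R}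
    (h : ∀ e, homogeneousComponent e f = 0) : f = 0 := by
  rw [← sum_homogeneousComponent f]
  exact Finset.sum_eq_zero fun i _ => h i

theorem homogeneousComponent_totalDegree_ne_zero {f : MvPolynomial σ R} (hf : f ≠ 0) :
    homogeneousComponent f.totalDegree f ≠ 0 := by
  intro h0
  obtain ⟨m, hm, hmd⟩ := Finset.exists_mem_eq_sup f.support (support_nonempty.2 hf)
    fun m => m.degree
  have hd : f.totalDegree = m.degree := by
    rw [← hmd, totalDegree]
    rfl
  have := congrArg (coeff m) h0
  rw [coeff_homogeneousComponent, if_pos hd.symm, coeff_zero] at this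
  exact mem_support_iff.1 hm this

theorem homogeneousComponent_eq_zero_or_eq_totalDegree {f : MvPolynomial σ R} {d : ℕ}
    (h : ∀ e, d < e → homogeneousComponent e f = 0) :
    homogeneousComponent d f = 0 ∨ f ≠ 0 ∧ f.totalDegree = d := by
  by_cases hf : f = 0
  · simp [hf]
  rcases lt_trichotomy f.totalDegree d with hd | hd | hd
  · exact Or.inl (homogeneousComponent_eq_zero _ _ hd)
  · exact Or.inr ⟨hf, hd⟩
  · exact absurd (h _ hd) (homogeneousComponent_totalDegree_ne_zero hf)

theorem homogeneousComponent_mem_span {B : Set (MvPolynomial σ R)}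
    (hB : ∀ b ∈ B, ∃ d, b.IsHomogeneous d) {v : MvPolynomial σ R}
    (hv : v ∈ Submodule.span R B) (d : ℕ) :
    homogeneousComponent d v ∈ Submodule.span R B := by
  suffices h : Submodule.span R B ≤ (Submodule.span R B).comap (homogeneousComponent d) from h hv
  rw [Submodule.span_le]
  intro b hb
  obtain ⟨e, he⟩ := hB b hb
  change homogeneousComponent d b ∈ Submodule.span R B
  rw [homogeneousComponent_of_mem he]
  split_ifs
  · exact Submodule.subset_span hb
  · exact Submodule.zero_mem _

/-- If a graded space `V = span B` satisfies `V + I = ⊤` for an ideal `I` of top degree forms of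
`N`, then every polynomial is congruent modulo `N` to an element of `V` of no larger degree. -/
theorem exists_mem_span_sub_mem {B : Set (MvPolynomial σ R)} {I N : Ideal (MvPolynomial σ R)}
    (hB : ∀ b ∈ B, ∃ d, b.IsHomogeneous d)
    (hspan : Submodule.span R B ⊔ I.restrictScalars R = ⊤) (hI : I ≤ topFormIdeal N)
    (d : ℕ) (p : MvPolynomial σ R) (hp : ∀ e, d ≤ e → homogeneousComponent e p = 0) :
    ∃ v ∈ Submodule.span R B, (∀ e, d ≤ e → homogeneousComponent e v = 0) ∧ p - v ∈ N := by
  induction d generalizing p with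
  | zero =>
    have := eq_zero_of_homogeneousComponent_eq_zero fun e => hp e e.zero_le
    exact ⟨0, Submodule.zero_mem _, by simp, by simp [this]⟩
  | succ d ih =>
    obtain ⟨v, hv, i, hi, hvi⟩ := Submodule.mem_sup.1 (hspan ▸ Submodule.mem_top (x := p))
    obtain ⟨f, hf, hf1, hf2⟩ := hI hi d
    have hv' := homogeneousComponent_mem_span hB hv d
    obtain ⟨w, hw, hw1, hw2⟩ := ih (p - f - homogeneousComponent d v) fun e he => by
      rcases he.eq_or_lt with rfl | he
      · rw [map_sub, map_sub, hf2, ← hvi, homogeneousComponent_homogeneousComponent_self, map_add]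
        ring
      · rw [map_sub, map_sub, hp e he, hf1 e he,
          homogeneousComponent_homogeneousComponent_of_ne he.ne']
        simp
    refine ⟨homogeneousComponent d v + w, Submodule.add_mem _ hv' hw, fun e he => ?_, ?_⟩
    · rw [map_add, homogeneousComponent_homogeneousComponent_of_ne (by omega), hw1 e (by omega),
        zero_add]
    · convert N.add_mem hf hw2 using 1
      ring

/-- If `I` consists of top degree forms of `N` and a set of `dim K[x] / N` homogeneous
polynomials (counted through a linear map `ev` with kernel `N`) spans modulo `I`, then `I`
contains all top degree forms of `N`. -/
theorem homogeneousComponent_totalDegree_mem_of_span {E : Type*} [AddCommGroup E] [Module K E]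
    [FiniteDimensional K E] {B : Finset (MvPolynomial σ K)} {I N : Ideal (MvPolynomial σ K)}
    (hB : ∀ b ∈ B, ∃ d, b.IsHomogeneous d)
    (hspan : Submodule.span K (B : Set (MvPolynomial σ K)) ⊔ I.restrictScalars K = ⊤)
    (hhom : ∀ p ∈ I, ∀ d, homogeneousComponent d p ∈ I)
    (hI : I ≤ topFormIdeal N) (ev : MvPolynomial σ K →ₗ[K] E) (hev : Function.Surjective ev)
    (hker : ∀ f, ev f = 0 ↔ f ∈ N) (hcard : B.card ≤ Module.finrank K E)
    {f : MvPolynomial σ K} (hf : f ∈ N) : homogeneousComponent f.totalDegree f ∈ I := by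
  set V := Submodule.span K (B : Set (MvPolynomial σ K)) with hV
  have : FiniteDimensional K V := FiniteDimensional.span_finset K B
  have hsurj : Function.Surjective (ev.domRestrict V) := by
    intro y
    obtain ⟨p, rfl⟩ := hev y
    obtain ⟨v, hv, -, hpv⟩ := exists_mem_span_sub_mem hB hspan hI (p.totalDegree + 1) p
      fun e he => homogeneousComponent_eq_zero _ _ he
    refine ⟨⟨v, hv⟩, ?_⟩
    rw [← hker, map_sub, sub_eq_zero] at hpv
    exact hpv.symm
  have hdim : Module.finrank K V = Module.finrank K E :=
    le_antisymm ((finrank_span_finset_le_card B).trans hcard)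
      (LinearMap.finrank_le_finrank_of_surjective hsurj)
  have hinj := (LinearMap.injective_iff_surjective_of_finrank_eq_finrank hdim).2 hsurj
  have hzero : ∀ v ∈ V, v ∈ N → v = 0 := fun v hv hvN => by
    have := @hinj ⟨v, hv⟩ 0 (by simpa using (hker v).2 hvN)
    simpa using this
  set d := f.totalDegree
  obtain ⟨v, hv, i, hi, hvi⟩ := Submodule.mem_sup.1
    (hspan ▸ Submodule.mem_top (x := homogeneousComponent d f))
  obtain ⟨g, hg, hg1, hg2⟩ := hI hi d
  have hsum := congrArg (homogeneousComponent d) hvi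
  rw [homogeneousComponent_homogeneousComponent_self, map_add] at hsum
  obtain ⟨w, hw, hw1, hw2⟩ := exists_mem_span_sub_mem hB hspan hI d
    (f - g - homogeneousComponent d v) fun e he => by
      rcases he.eq_or_lt with rfl | he
      · rw [map_sub, map_sub, hg2, ← hsum, homogeneousComponent_homogeneousComponent_self]
        ring
      · rw [map_sub, map_sub, homogeneousComponent_eq_zero _ _ he, hg1 e he,
          homogeneousComponent_homogeneousComponent_of_ne he.ne']
        simp
  have hvw : homogeneousComponent d v + w = 0 :=
    hzero _ (V.add_mem (homogeneousComponent_mem_span hB hv d) hw) <| by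
      convert N.sub_mem (N.sub_mem hf hg) hw2 using 1
      ring
  have hv0 := congrArg (homogeneousComponent d) hvw
  rw [map_add, homogeneousComponent_homogeneousComponent_self, hw1 d le_rfl, add_zero,
    map_zero] at hv0
  rw [← hsum, hv0, zero_add]
  exact hhom i hi d

end TopForm

section Staircase

variable (R : Type*) [CommRing R]

theorem isHomogeneous_esymm {σ : Type*} [Fintype σ] (d : ℕ) : (esymm σ R d).IsHomogeneous d := by
  refine IsHomogeneous.sum _ _ _ fun s hs => ?_
  have := IsHomogeneous.prod s (fun i => (X i : MvPolynomial σ R)) (fun _ => 1)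
    fun i _ => isHomogeneous_X R i
  simpa [(Finset.mem_powersetCard.1 hs).2] using this

theorem esymm_eq_zero_of_card_lt {σ : Type*} [Fintype σ] {d : ℕ} (h : Fintype.card σ < d) :
    esymm σ R d = 0 := by
  rw [esymm, Finset.powersetCard_eq_empty.2 (by simpa using h), Finset.sum_empty]

theorem esymm_fin_succ (n d : ℕ) : esymm (Fin (n + 1)) R (d + 1) =
    rename Fin.succ (esymm (Fin n) R (d + 1)) + X 0 * rename Fin.succ (esymm (Fin n) R d) := by
  have h : ∀ e, rename Fin.succ (esymm (Fin n) R e) =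
      (Finset.univ.val.map fun i : Fin n => (X i.succ : MvPolynomial (Fin (n + 1)) R)).esymm e :=
    fun e => by
      have hr : rename (R := R) (Fin.succ (n := n)) = aeval fun i => X i.succ :=
        algHom_ext fun i => by simp
      rw [hr, aeval_esymm_eq_multiset_esymm]
  rw [h, h, esymm_eq_multiset_esymm, Fin.univ_succ]
  simp only [Multiset.esymm, Finset.cons_val, Finset.map_val, Multiset.map_cons, Multiset.map_map,
    Multiset.powersetCard_cons, Multiset.map_add, Multiset.sum_add, Multiset.prod_cons,
    Multiset.sum_map_mul_left, Function.comp_def, Function.Embedding.coeFn_mk]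

/-- The ideal generated by `x_i ^ k` for all `i` and by `e_d` for all `d > n - s`. -/
noncomputable def powEsymmIdeal (n k s : ℕ) : Ideal (MvPolynomial (Fin n) R) :=
  Ideal.span ({p | ∃ i, p = X i ^ k} ∪ {p | ∃ d, n < d + s ∧ p = esymm (Fin n) R d})

variable {R} {n k s : ℕ}

theorem X_pow_mem_powEsymmIdeal (i : Fin n) : X i ^ k ∈ powEsymmIdeal R n k s :=
  Ideal.subset_span (Or.inl ⟨i, rfl⟩)

theorem esymm_mem_powEsymmIdeal {d : ℕ} (h : n < d + s) :
    esymm (Fin n) R d ∈ powEsymmIdeal R n k s :=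
  Ideal.subset_span (Or.inr ⟨d, h, rfl⟩)

theorem homogeneousComponent_mem_powEsymmIdeal {p : MvPolynomial (Fin n) R}
    (hp : p ∈ powEsymmIdeal R n k s) (d : ℕ) :
    homogeneousComponent d p ∈ powEsymmIdeal R n k s := by
  let := gradedAlgebra (σ := Fin n) (R := R)
  refine homogeneousComponent_mem_of_mem (Ideal.homogeneous_span _ _ ?_) hp d
  rintro _ (⟨i, rfl⟩ | ⟨e, -, rfl⟩)
  · exact ⟨_, isHomogeneous_X_pow i k⟩
  · exact ⟨e, isHomogeneous_esymm R e⟩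

theorem X_zero_pow_mul_rename_esymm_mem {m d : ℕ} (hm : m ≤ s) (hd : n < d + m) :
    X 0 ^ m * rename Fin.succ (esymm (Fin n) R d) ∈ powEsymmIdeal R (n + 1) k s := by
  induction m generalizing d with
  | zero => simp [esymm_eq_zero_of_card_lt R (σ := Fin n) (d := d) (by simpa using hd)]
  | succ m ih =>
    have h1 := Ideal.mul_mem_left _ (X 0 ^ m)
      (esymm_mem_powEsymmIdeal (R := R) (n := n + 1) (k := k) (s := s) (d := d + 1) (by omega))
    convert Ideal.sub_mem _ h1 (ih (d := d + 1) (by omega) (by omega)) using 1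
    rw [esymm_fin_succ]
    ring

theorem X_pow_mul_rename_mem {j s' : ℕ} (h : s' + 1 = s ∨ s' = s ∧ s ≤ j)
    {p : MvPolynomial (Fin n) R} (hp : p ∈ powEsymmIdeal R n k s') :
    X 0 ^ j * rename Fin.succ p ∈ powEsymmIdeal R (n + 1) k s ⊔ Ideal.span {X 0 ^ (j + 1)} := by
  suffices hle : powEsymmIdeal R n k s' ≤ ((powEsymmIdeal R (n + 1) k s ⊔
      Ideal.span {X 0 ^ (j + 1)}).colon {X 0 ^ j}).comap (rename Fin.succ) by
    have := hle hp
    rw [Ideal.mem_comap, Submodule.mem_colon_singleton, smul_eq_mul, mul_comm] at this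
    exact this
  refine Ideal.span_le.2 ?_
  intro q hq
  rw [SetLike.mem_coe, Ideal.mem_comap, Submodule.mem_colon_singleton, smul_eq_mul, mul_comm]
  obtain ⟨i, rfl⟩ | ⟨d, hd, rfl⟩ := hq
  · refine Ideal.mul_mem_left _ _ (Ideal.mem_sup_left ?_)
    rw [map_pow, rename_X]
    exact X_pow_mem_powEsymmIdeal _
  obtain rfl | ⟨rfl, hj⟩ := h
  · cases d with
    | zero =>
      refine Ideal.mul_mem_left _ _ (Ideal.mem_sup_left ?_)
      simpa using esymm_mem_powEsymmIdeal (R := R) (n := n + 1) (k := k) (s := s' + 1) (d := 0)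
        (by omega)
    | succ d =>
      have h1 := esymm_mem_powEsymmIdeal (R := R) (n := n + 1) (k := k) (s := s' + 1) (d := d + 1)
        (by omega)
      rw [esymm_fin_succ] at h1
      refine Submodule.mem_sup.2 ⟨_, Ideal.mul_mem_left _ (X 0 ^ j) h1, _, Ideal.mul_mem_left _
        (-rename Fin.succ (esymm (Fin n) R d)) (Ideal.mem_span_singleton_self _), ?_⟩
      ring
  · obtain ⟨t, rfl⟩ := Nat.exists_eq_add_of_le hj
    rw [add_comm s' t, pow_add _ t s', mul_assoc]
    exact Ideal.mul_mem_left _ _ (Ideal.mem_sup_left (X_zero_pow_mul_rename_esymm_mem le_rfl hd))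

theorem exists_eq_rename_succ_add_X_zero_mul (p : MvPolynomial (Fin (n + 1)) R) :
    ∃ q r, p = rename Fin.succ q + X 0 * r := by
  induction p using MvPolynomial.induction_on with
  | C a => exact ⟨C a, 0, by simp⟩
  | add p p' hp hp' =>
    obtain ⟨q, r, rfl⟩ := hp
    obtain ⟨q', r', rfl⟩ := hp'
    exact ⟨q + q', r + r', by rw [map_add]; ring⟩
  | mul_X p i hp =>
    obtain ⟨q, r, rfl⟩ := hp
    cases i using Fin.cases with
    | zero => exact ⟨0, rename Fin.succ q + X 0 * r, by simp [mul_comm]⟩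
    | succ i => exact ⟨q * X i, r * X i.succ, by rw [map_mul, rename_X]; ring⟩

/-- The number of maps from a set of size `n` to a set of size `k` whose range contains a given
subset of size `s`, defined by recursion on `n`. -/
def coverCount (k : ℕ) : ℕ → ℕ → ℕ
  | 0, 0 => 1
  | 0, _ + 1 => 0
  | n + 1, s => s * coverCount k n (s - 1) + (k - s) * coverCount k n s

theorem card_subset_image_eq_coverCount (n : ℕ) (S : Finset (Fin k)) :
    (Finset.univ.filter fun w : Fin n → Fin k => S ⊆ Finset.univ.image w).card =
      coverCount k n S.card := by
  induction n generalizing S with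
  | zero =>
    rcases S.eq_empty_or_nonempty with rfl | hS
    · simp [coverCount]
    · obtain ⟨c, hc⟩ := Nat.exists_eq_succ_of_ne_zero hS.card_pos.ne'
      simp [hc, coverCount, hS.ne_empty]
  | succ n ih =>
    have h (a : Fin k) : (Finset.univ.filter fun w : Fin n → Fin k =>
        S ⊆ Finset.univ.image (Fin.cons a w : Fin (n + 1) → Fin k)).card =
        coverCount k n (S.erase a).card := by
      have hcons (w : Fin n → Fin k) : Finset.univ.image (Fin.cons a w : Fin (n + 1) → Fin k) =
          insert a (Finset.univ.image w) := by
        ext b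
        simp [Fin.exists_fin_succ, eq_comm]
      simp only [← ih, hcons, Finset.subset_insert_iff]
    calc _ = ∑ a : Fin k, (Finset.univ.filter fun w : Fin n → Fin k =>
          S ⊆ Finset.univ.image (Fin.cons a w : Fin (n + 1) → Fin k)).card := by
          simp only [Finset.card_filter]
          rw [← Fintype.sum_prod_type' (f := fun a (w : Fin n → Fin k) =>
            if S ⊆ Finset.univ.image (Fin.cons a w : Fin (n + 1) → Fin k) then 1 else 0)]
          exact (Equiv.sum_comp (Fin.consEquiv fun _ => Fin k) _).symm
      _ = ∑ a : Fin k, coverCount k n (if a ∈ S then S.card - 1 else S.card) := by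
          refine Finset.sum_congr rfl fun a _ => ?_
          rw [h, Finset.card_erase_eq_ite]
      _ = _ := by
          simp [apply_ite (coverCount k n), Finset.sum_ite, coverCount, Finset.filter_not,
            Finset.card_sdiff]

/-- Modulo `powEsymmIdeal R n k s`, polynomials are spanned by `coverCount k n s` homogeneous
ones. -/
theorem exists_finset_span_sup_powEsymmIdeal (hs : s ≤ k) :
    ∃ B : Finset (MvPolynomial (Fin n) R), B.card ≤ coverCount k n s ∧
      (∀ b ∈ B, ∃ d, b.IsHomogeneous d) ∧
      Submodule.span R (B : Set (MvPolynomial (Fin n) R)) ⊔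
        (powEsymmIdeal R n k s).restrictScalars R = ⊤ := by
  classical
  induction n generalizing s with
  | zero =>
    cases s with
    | zero =>
      refine ⟨{1}, by simp [coverCount], by simpa using ⟨0, isHomogeneous_one _ _⟩, ?_⟩
      refine eq_top_iff.2 fun p _ => Submodule.mem_sup_left ?_
      rw [Finset.coe_singleton, Submodule.mem_span_singleton, eq_C_of_isEmpty p]
      exact ⟨_, by rw [← C_mul', mul_one]⟩
    | succ s =>
      refine ⟨∅, by simp [coverCount], by simp, ?_⟩
      have : powEsymmIdeal R 0 k (s + 1) = ⊤ := by
        rw [Ideal.eq_top_iff_one]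
        simpa using esymm_mem_powEsymmIdeal (R := R) (n := 0) (k := k) (s := s + 1) (d := 0)
          (by omega)
      simp [this]
  | succ n ih =>
    have hlow (j : ℕ) : ∃ B : Finset (MvPolynomial (Fin n) R),
        B.card ≤ (if j < s then coverCount k n (s - 1) else coverCount k n s) ∧
        (∀ b ∈ B, ∃ d, b.IsHomogeneous d) ∧
        Submodule.span R (B : Set (MvPolynomial (Fin n) R)) ⊔
          (powEsymmIdeal R n k (if j < s then s - 1 else s)).restrictScalars R = ⊤ := by
      split_ifs
      · exact ih (by omega)
      · exact ih hs
    choose B hcard hhom hspan using hlow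
    set B' : Finset (MvPolynomial (Fin (n + 1)) R) := (Finset.range k).biUnion fun j =>
      (B j).image fun b => X 0 ^ j * rename Fin.succ b with hB'
    refine ⟨B', ?_, ?_, ?_⟩
    · calc B'.card ≤ ∑ j ∈ Finset.range k,
            (if j < s then coverCount k n (s - 1) else coverCount k n s) :=
          Finset.card_biUnion_le.trans <| Finset.sum_le_sum fun j _ =>
            Finset.card_image_le.trans (hcard j)
        _ = coverCount k (n + 1) s := by
          have h1 : (Finset.range k).filter (· < s) = Finset.range s := by
            ext; simp; omega
          have h2 : (Finset.range k).filter (¬ · < s) = Finset.Ico s k := by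
            ext; simp; omega
          rw [Finset.sum_ite, h1, h2]
          simp [coverCount]
    · intro b hb
      simp only [hB', Finset.mem_biUnion, Finset.mem_image] at hb
      obtain ⟨j, -, b, hb, rfl⟩ := hb
      obtain ⟨d, hd⟩ := hhom j b hb
      exact ⟨j + d, (isHomogeneous_X_pow _ _).mul hd.rename_isHomogeneous⟩
    · set M := Submodule.span R (B' : Set (MvPolynomial (Fin (n + 1)) R)) ⊔
        (powEsymmIdeal R (n + 1) k s).restrictScalars R with hM
      have hI : ∀ p ∈ powEsymmIdeal R (n + 1) k s, p ∈ M := fun p hp => Submodule.mem_sup_right hp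
      suffices h : ∀ t j, j + t = k → ∀ p, X 0 ^ j * p ∈ M by
        refine eq_top_iff.2 fun p _ => ?_
        simpa using h k 0 (by omega) p
      intro t
      induction t with
      | zero =>
        rintro j rfl p
        exact hI _ (Ideal.mul_mem_right _ _ (X_pow_mem_powEsymmIdeal _))
      | succ t iht =>
        intro j hj p
        obtain ⟨q, r, rfl⟩ := exists_eq_rename_succ_add_X_zero_mul p
        obtain ⟨v, hv, i, hi, rfl⟩ := Submodule.mem_sup.1
          (hspan j ▸ Submodule.mem_top (x := q))
        have hi' := X_pow_mul_rename_mem (s := s) (j := j) (by split_ifs <;> omega) hi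
        obtain ⟨i₁, hi₁, i₂, hi₂, hii⟩ := Submodule.mem_sup.1 hi'
        obtain ⟨c, rfl⟩ := Ideal.mem_span_singleton.1 hi₂
        have hvM : X 0 ^ j * rename Fin.succ v ∈ M := by
          refine Submodule.mem_sup_left ?_
          have := Submodule.mem_map_of_mem (f := (LinearMap.mulLeft R (X 0 ^ j)).comp
            (rename (R := R) (Fin.succ (n := n))).toLinearMap) hv
          rw [Submodule.map_span] at this
          refine Submodule.span_mono ?_ this
          rintro _ ⟨b, hb, rfl⟩
          simp only [hB', Finset.coe_biUnion, Set.mem_iUnion]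
          exact ⟨j, by simp; omega, Finset.mem_coe.2 (Finset.mem_image_of_mem _ hb)⟩
        have := M.add_mem (M.add_mem hvM (hI _ hi₁)) (iht (j + 1) (by omega) (c + r))
        convert this using 1
        rw [map_add, mul_add, mul_add, ← hii]
        ring

end Staircase

section SurjectivePoints

variable {K : Type*} [Field K] {n k : ℕ} {α : Fin k → K}

theorem mem_topFormIdeal_of_isHomogeneous {σ R : Type*} [CommRing R]
    {N : Ideal (MvPolynomial σ R)} {q f : MvPolynomial σ R} {d : ℕ} (hq : q.IsHomogeneous d)
    (hf : f ∈ N) (hlt : ∀ e, d < e → homogeneousComponent e f = 0)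
    (hd : homogeneousComponent d f = q) : q ∈ topFormIdeal N := by
  intro e
  by_cases h : e = d
  · subst h
    exact ⟨f, hf, hlt, by rw [hd, homogeneousComponent_eq_self hq]⟩
  · exact ⟨0, N.zero_mem, by simp, by rw [map_zero, homogeneousComponent_of_mem hq, if_neg h]⟩

theorem homogeneousComponent_sum_C_mul {σ R : Type*} [CommRing R] {g : ℕ → MvPolynomial σ R}
    (hg : ∀ j, (g j).IsHomogeneous j) (c : ℕ → R) (m d : ℕ) :
    homogeneousComponent d (∑ j ∈ Finset.range m, C (c j) * g j) =
      if d < m then C (c d) * g d else 0 := by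
  simp [map_sum, homogeneousComponent_C_mul, homogeneousComponent_of_mem (hg _)]

/-- The points whose set of coordinates is exactly the range of `α`. -/
def surjectivePoints (n : ℕ) (α : Fin k → K) : Set (Fin n → K) :=
  {y | Set.range y = Set.range α}

theorem mem_surjectivePoints_iff {L : Type*} {α : Fin k → L} (hα : Function.Injective α)
    {y : Fin n → L} :
    y ∈ surjectivePoints n α ↔ ∃ w : Fin n → Fin k, Function.Surjective w ∧ α ∘ w = y := by
  constructor
  · intro hy
    have h : ∀ i, ∃ j, α j = y i := fun i => hy.subset ⟨i, rfl⟩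
    choose w hw using h
    refine ⟨w, fun j => ?_, _root_.funext hw⟩
    obtain ⟨i, hi⟩ := hy.superset ⟨j, rfl⟩
    exact ⟨i, hα ((hw i).trans hi)⟩
  · rintro ⟨w, hw, rfl⟩
    exact hw.range_comp α

theorem X_pow_mem_topFormIdeal (i : Fin n) :
    X i ^ k ∈ topFormIdeal (vanishingIdeal K (surjectivePoints n α)) := by
  set A := Lagrange.nodal Finset.univ α with hA
  have hdeg : A.natDegree = k := by simp [hA]
  have hsum : Polynomial.aeval (X i) A =
      ∑ j ∈ Finset.range (k + 1), C (A.coeff j) * (X i : MvPolynomial (Fin n) K) ^ j := by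
    rw [Polynomial.aeval_eq_sum_range, hdeg]
    simp [C_mul']
  have hhom : ∀ j, ((X i : MvPolynomial (Fin n) K) ^ j).IsHomogeneous j :=
    fun j => isHomogeneous_X_pow i j
  refine mem_topFormIdeal_of_isHomogeneous (f := Polynomial.aeval (X i) A) (hhom k)
    ?_ (fun e he => ?_) ?_
  · intro y hy
    obtain ⟨j, hj⟩ := hy.subset ⟨i, rfl⟩
    rw [← Polynomial.aeval_algHom_apply, aeval_X, ← hj, Polynomial.coe_aeval_eq_eval]
    exact Lagrange.eval_nodal_at_node (Finset.mem_univ j)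
  · rw [hsum, homogeneousComponent_sum_C_mul hhom, if_neg (by omega)]
  · have hlead : A.coeff k = 1 := by
      rw [← hdeg]
      exact Lagrange.nodal_monic
    rw [hsum, homogeneousComponent_sum_C_mul hhom, if_pos (by omega), hlead, C_1, one_mul]

theorem nodal_dvd_prod_X_sub_C (hα : Function.Injective α) {y : Fin n → K}
    (hy : y ∈ surjectivePoints n α) :
    Lagrange.nodal Finset.univ α ∣ ∏ i, (Polynomial.X - Polynomial.C (y i)) := by
  classical
  obtain ⟨w, hw, rfl⟩ := (mem_surjectivePoints_iff hα).1 hy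
  calc Lagrange.nodal Finset.univ α
      = ∏ i ∈ Finset.univ.image (Function.surjInv hw),
          (Polynomial.X - Polynomial.C ((α ∘ w) i)) := by
        rw [Finset.prod_image (Function.injective_surjInv hw).injOn, Lagrange.nodal]
        simp [Function.surjInv_eq]
    _ ∣ _ := Finset.prod_dvd_prod_of_subset _ _ _ (Finset.subset_univ _)

theorem esymm_mem_topFormIdeal (hα : Function.Injective α) {d : ℕ} (hd : n < d + k) :
    esymm (Fin n) K d ∈ topFormIdeal (vanishingIdeal K (surjectivePoints n α)) := by
  rcases lt_or_ge n d with hnd | hdn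
  · rw [esymm_eq_zero_of_card_lt K (by simpa using hnd)]
    exact Ideal.zero_mem _
  set A := Lagrange.nodal Finset.univ α with hA
  have hmonic : A.Monic := Lagrange.nodal_monic
  have hdeg : A.degree = k := by simp [hA]
  set φ : Polynomial K →ₗ[K] K := (Polynomial.lcoeff K (n - d)).comp (Polynomial.modByMonicHom A)
    with hφ
  have hφX : ∀ j, d ≤ j → j ≤ n → φ (Polynomial.X ^ (n - j)) = if j = d then 1 else 0 := by
    intro j hj hjn
    have : φ (Polynomial.X ^ (n - j)) = (Polynomial.X ^ (n - j) %ₘ A).coeff (n - d) := rfl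
    rw [this, (Polynomial.modByMonic_eq_self_iff hmonic).2, Polynomial.coeff_X_pow]
    · congr 1
      rw [eq_iff_iff]
      omega
    · rw [hdeg, Polynomial.degree_X_pow]
      exact_mod_cast (by omega : n - j < k)
  set c : ℕ → K := fun j => (-1) ^ d * ((-1) ^ j * φ (Polynomial.X ^ (n - j))) with hc
  have hhom := fun j => isHomogeneous_esymm K (σ := Fin n) j
  refine mem_topFormIdeal_of_isHomogeneous
    (f := ∑ j ∈ Finset.range (n + 1), C (c j) * esymm (Fin n) K j) (hhom d) ?_ (fun e he => ?_) ?_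
  · intro y hy
    have hzero : φ (∏ i, (Polynomial.X - Polynomial.C (y i))) = 0 := by
      have := (Polynomial.modByMonic_eq_zero_iff_dvd hmonic).2 (nodal_dvd_prod_X_sub_C hα hy)
      change (_ %ₘ A).coeff _ = 0
      rw [this, Polynomial.coeff_zero]
    have hprod : ∏ i, (Polynomial.X - Polynomial.C (y i)) = ∑ j ∈ Finset.range (n + 1),
        ((-1) ^ j * aeval y (esymm (Fin n) K j)) • (Polynomial.X : Polynomial K) ^ (n - j) := by
      have := Multiset.prod_X_sub_X_eq_sum_esymm (Finset.univ.val.map y)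
      rw [Multiset.map_map] at this
      refine Eq.trans this ?_
      simp [aeval_esymm_eq_multiset_esymm, Polynomial.smul_eq_C_mul, mul_assoc]
    rw [hprod, map_sum] at hzero
    simp only [map_smul, smul_eq_mul] at hzero
    rw [map_sum, ← mul_zero ((-1) ^ d), ← hzero, Finset.mul_sum]
    refine Finset.sum_congr rfl fun j _ => ?_
    rw [map_mul, aeval_C, Algebra.algebraMap_self_apply, hc]
    ring
  · rw [homogeneousComponent_sum_C_mul hhom]
    split_ifs with h
    · simp [hc, hφX e he.le (by omega), he.ne']
    · rfl
  · rw [homogeneousComponent_sum_C_mul hhom, if_pos (by omega)]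
    simp [hc, hφX d le_rfl hdn, ← mul_pow]

theorem powEsymmIdeal_le_topFormIdeal (hα : Function.Injective α) :
    powEsymmIdeal K n k k ≤ topFormIdeal (vanishingIdeal K (surjectivePoints n α)) := by
  refine Ideal.span_le.2 ?_
  rintro _ (⟨i, rfl⟩ | ⟨d, hd, rfl⟩)
  · exact X_pow_mem_topFormIdeal i
  · exact esymm_mem_topFormIdeal hα hd

variable (n α) in
/-- Evaluation of polynomials at the points `α ∘ w` for `w` surjective. -/
noncomputable def evalSurjective :
    MvPolynomial (Fin n) K →ₗ[K] ({w : Fin n → Fin k // Function.Surjective w} → K) :=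
  LinearMap.pi fun w => (aeval (α ∘ w.1)).toLinearMap

theorem evalSurjective_apply (f : MvPolynomial (Fin n) K)
    (w : {w : Fin n → Fin k // Function.Surjective w}) :
    evalSurjective n α f w = aeval (α ∘ w.1) f := rfl

theorem evalSurjective_eq_zero_iff (hα : Function.Injective α) (f : MvPolynomial (Fin n) K) :
    evalSurjective n α f = 0 ↔ f ∈ vanishingIdeal K (surjectivePoints n α) := by
  rw [mem_vanishingIdeal_iff, _root_.funext_iff]
  constructor
  · intro h y hy
    obtain ⟨w, hw, rfl⟩ := (mem_surjectivePoints_iff hα).1 hy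
    exact h ⟨w, hw⟩
  · intro h w
    exact h _ ((mem_surjectivePoints_iff hα).2 ⟨w.1, w.2, rfl⟩)

theorem evalSurjective_surjective (hα : Function.Injective α) :
    Function.Surjective (evalSurjective n α) := by
  classical
  intro g
  refine ⟨∑ w, C (g w) * ∏ i, Polynomial.aeval (X i) (Lagrange.basis Finset.univ α (w.1 i)), ?_⟩
  have hbasis (w v : Fin n → Fin k) :
      ∏ i, (Lagrange.basis Finset.univ α (w i)).eval (α (v i)) = if v = w then 1 else 0 := by
    split_ifs with h
    · subst h
      exact Finset.prod_eq_one fun i _ => Lagrange.eval_basis_self hα.injOn (Finset.mem_univ _)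
    · obtain ⟨i, hi⟩ := Function.ne_iff.1 h
      exact Finset.prod_eq_zero (Finset.mem_univ i)
        (Lagrange.eval_basis_of_ne hi.symm (Finset.mem_univ _))
  ext v
  simp only [evalSurjective_apply, map_sum, map_mul, map_prod, aeval_C,
    ← Polynomial.aeval_algHom_apply, aeval_X, Function.comp_apply, Polynomial.coe_aeval_eq_eval,
    hbasis, Algebra.algebraMap_self_apply]
  simp [← Subtype.ext_iff]

theorem card_surjective_eq_coverCount (n k : ℕ) :
    Fintype.card {w : Fin n → Fin k // Function.Surjective w} = coverCount k n k := by
  classical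
  have := card_subset_image_eq_coverCount n (Finset.univ : Finset (Fin k))
  rw [Finset.card_univ, Fintype.card_fin] at this
  rw [← this, Fintype.card_subtype]
  congr 1
  ext w
  rw [Finset.mem_filter, Finset.mem_filter]
  simp [Finset.univ_subset_iff, Finset.eq_univ_iff_forall, Function.Surjective]

/-- The top degree form of every polynomial vanishing on `surjectivePoints n α` lies in
`powEsymmIdeal K n k k`. -/
theorem homogeneousComponent_totalDegree_mem_powEsymmIdeal (hα : Function.Injective α)
    {f : MvPolynomial (Fin n) K} (hf : f ∈ vanishingIdeal K (surjectivePoints n α)) :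
    homogeneousComponent f.totalDegree f ∈ powEsymmIdeal K n k k := by
  classical
  obtain ⟨B, hcard, hB, hspan⟩ := exists_finset_span_sup_powEsymmIdeal (R := K) (n := n) le_rfl
  refine homogeneousComponent_totalDegree_mem_of_span hB hspan
    (fun p hp => homogeneousComponent_mem_powEsymmIdeal hp) (powEsymmIdeal_le_topFormIdeal hα)
    (evalSurjective n α) (evalSurjective_surjective hα) (evalSurjective_eq_zero_iff hα) ?_ hf
  rwa [Module.finrank_fintype_fun_eq_card, card_surjective_eq_coverCount]

end SurjectivePoints

end MvPolynomial

theorem mem_topIdeal_of_isHomogeneous {n k d : ℕ} {α : Fin k → ℚ}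
    {q : MvPolynomial (Fin n) ℚ} (hq : q.IsHomogeneous d)
    (h : q ∈ topFormIdeal (vanishingIdeal ℚ (surjectivePoints n α))) : q ∈ topIdeal n k α := by
  obtain ⟨f, hf, hlt, hd⟩ := h d
  rw [homogeneousComponent_eq_self hq] at hd
  rcases homogeneousComponent_eq_zero_or_eq_totalDegree hlt with h0 | ⟨hf0, rfl⟩
  · rw [← hd, h0]
    exact Ideal.zero_mem _
  · exact Ideal.subset_span ⟨f, hf0, fun y hy => hf y hy, hd.symm⟩

theorem Ink_eq_powEsymmIdeal {n k : ℕ} (hkn : k ≤ n) : Ink n k = powEsymmIdeal ℚ n k k := by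
  refine le_antisymm (Ideal.span_mono ?_) (Ideal.span_le.2 ?_)
  · refine Set.union_subset_union_right _ ?_
    rintro _ ⟨d, hd, -, rfl⟩
    exact ⟨d, by omega, rfl⟩
  · rintro _ (⟨i, rfl⟩ | ⟨d, hd, rfl⟩)
    · exact Ideal.subset_span (Or.inl ⟨i, rfl⟩)
    · rcases lt_or_ge n d with hnd | hdn
      · rw [esymm_eq_zero_of_card_lt ℚ (by simpa using hnd)]
        exact Ideal.zero_mem _
      · exact Ideal.subset_span (Or.inr ⟨d, by omega, hdn, rfl⟩)

theorem stmt8 (n k : ℕ) (hk : 1 ≤ k) (hkn : k ≤ n)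
    (α : Fin k → ℚ) (hα : Function.Injective α) :
    Ink n k = topIdeal n k α := by
  apply le_antisymm
  · refine Ideal.span_le.2 ?_
    rintro _ (⟨i, rfl⟩ | ⟨d, hd, -, rfl⟩)
    · exact mem_topIdeal_of_isHomogeneous (isHomogeneous_X_pow i k) (X_pow_mem_topFormIdeal i)
    · exact mem_topIdeal_of_isHomogeneous (isHomogeneous_esymm ℚ d)
        (esymm_mem_topFormIdeal hα (by omega))
  · rw [Ink_eq_powEsymmIdeal hkn]
    refine Ideal.span_le.2 ?_
    rintro _ ⟨f, -, hf, rfl⟩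
    exact homogeneousComponent_totalDegree_mem_powEsymmIdeal hα fun y hy => hf y hy
end

section
/- Let k ≤ n be positive integers. The images under the quotient map ℚ[x_1, …, x_n] → R_{n,k} of the monomials in A_{n,k} form a basis of R_{n,k} as a ℚ-vector space. -/
open MvPolynomial

/-- `b : Fin n → ℕ` is an `(n,k)`-staircase: a shuffle of `(0, 1, …, k−1)` with `n−k`
copies of `k−1`. -/
def IsStaircase (n k : ℕ) (b : Fin n → ℕ) : Prop :=
  ∃ p : Fin k → Fin n, StrictMono p ∧ (∀ t : Fin k, b (p t) = (t : ℕ)) ∧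
    ∀ i : Fin n, (∀ t : Fin k, p t ≠ i) → b i = k - 1

/-- Exponent vectors of monomials in the generalized Artin set `A_{n,k}`: those
componentwise below some `(n,k)`-staircase. -/
def ArtinExp (n k : ℕ) : Type :=
  {a : Fin n → ℕ // ∃ b : Fin n → ℕ, IsStaircase n k b ∧ ∀ i : Fin n, a i ≤ b i}

/-- Exponent sequences bounded by a shuffle of `(0, …, s - 1)` with copies of `k - 1`,
described recursively on the last entry. -/
def IsSubStaircase (k : ℕ) : (n : ℕ) → ℕ → (Fin n → ℕ) → Prop
  | 0, s, _ => s = 0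
  | n + 1, s, a => a (Fin.last n) < k ∧
      IsSubStaircase k n (if a (Fin.last n) < s then s - 1 else s) fun i => a i.castSucc

namespace IsSubStaircase

variable {k n s : ℕ} {a : Fin n → ℕ}

theorem pred (h : IsSubStaircase k n s a) : IsSubStaircase k n (s - 1) a := by
  induction n generalizing s with
  | zero =>
    simp only [IsSubStaircase] at h ⊢
    omega
  | succ n ih =>
    refine ⟨h.1, ?_⟩
    have h2 := h.2
    by_cases h3 : a (Fin.last n) < s
    · rw [if_pos h3] at h2
      split_ifs
      · exact ih h2
      · exact h2
    · rw [if_neg h3] at h2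
      rw [if_neg (by omega)]
      exact ih h2

theorem snoc {a : Fin n → ℕ} {j : ℕ} (hj : j < k)
    (h : IsSubStaircase k n (if j < s then s - 1 else s) a) :
    IsSubStaircase k (n + 1) s (Fin.snoc a j : Fin (n + 1) → ℕ) := by
  refine ⟨by simpa using hj, ?_⟩
  simpa using h

theorem exists_strictMono (h : IsSubStaircase k n s a) :
    ∃ p : Fin s → Fin n, StrictMono p ∧ (∀ t, a (p t) ≤ t) ∧ ∀ i, a i < k := by
  induction n generalizing s with
  | zero =>
    simp only [IsSubStaircase] at h
    subst h
    exact ⟨Fin.elim0, fun i => i.elim0, fun i => i.elim0, fun i => i.elim0⟩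
  | succ n ih =>
    obtain ⟨hk, h2⟩ := h
    split_ifs at h2 with hs
    · obtain ⟨s, rfl⟩ : ∃ s', s = s' + 1 := ⟨s - 1, by omega⟩
      obtain ⟨p, hp, hpa, ha⟩ := ih h2
      refine ⟨Fin.snoc (fun t : Fin s => (p t).castSucc) (Fin.last n), ?_, ?_, ?_⟩
      · intro i j hij
        induction j using Fin.lastCases with
        | last =>
          induction i using Fin.lastCases with
          | last => exact absurd hij (lt_irrefl _)
          | cast i => simp
        | cast j =>
          induction i using Fin.lastCases with
          | last => exact absurd hij (not_lt.2 (Fin.le_last _))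
          | cast i => simpa using hp (by simpa using hij)
      · intro t
        induction t using Fin.lastCases with
        | last => simpa using Nat.lt_succ_iff.1 hs
        | cast t => simpa using hpa t
      · intro i
        induction i using Fin.lastCases with
        | last => exact hk
        | cast i => exact ha i
    · obtain ⟨p, hp, hpa, ha⟩ := ih h2
      refine ⟨fun t => (p t).castSucc, fun i j hij => by simpa using hp hij, hpa, ?_⟩
      intro i
      induction i using Fin.lastCases with
      | last => exact hk
      | cast i => exact ha i

theorem of_strictMono {p : Fin s → Fin n} (hp : StrictMono p) (hpa : ∀ t, a (p t) ≤ t)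
    (ha : ∀ i, a i < k) : IsSubStaircase k n s a := by
  induction n generalizing s with
  | zero =>
    rcases s with _ | s
    · rfl
    · exact (p 0).elim0
  | succ n ih =>
    refine ⟨ha _, ?_⟩
    have key : (∀ t, p t ≠ Fin.last n) → IsSubStaircase k n s fun i => a i.castSucc := by
      intro h
      refine ih (p := fun t => (p t).castPred (h t)) ?_ ?_ fun i => ha _
      · intro i j hij
        simpa using hp hij
      · intro t
        simpa using hpa t
    by_cases h : ∀ t, p t ≠ Fin.last n
    · split_ifs
      · exact (key h).pred
      · exact key h
    · push Not at h
      obtain ⟨t, ht⟩ := h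
      rcases s with _ | s
      · exact t.elim0
      have htl : t = Fin.last s := by
        by_contra hne
        have := hp (Fin.lt_last_iff_ne_last.2 hne)
        rw [ht] at this
        exact absurd this (not_lt.2 (Fin.le_last _))
      subst htl
      have h1 : a (Fin.last n) < s + 1 := by
        have := hpa (Fin.last s)
        rw [ht] at this
        simpa [Nat.lt_succ_iff] using this
      rw [if_pos h1]
      have h3 (u : Fin s) : p u.castSucc ≠ Fin.last n := by
        rw [← ht]
        exact (hp (Fin.castSucc_lt_last u)).ne
      refine ih (p := fun t => (p t.castSucc).castPred (h3 t)) ?_ ?_ fun i => ha _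
      · intro i j hij
        simpa using hp (Fin.castSucc_lt_castSucc_iff.2 hij)
      · intro t
        simpa using hpa t.castSucc

end IsSubStaircase

theorem exists_isStaircase_iff {n k : ℕ} (hk : 1 ≤ k) (a : Fin n → ℕ) :
    (∃ b : Fin n → ℕ, IsStaircase n k b ∧ ∀ i, a i ≤ b i) ↔ IsSubStaircase k n k a := by
  constructor
  · rintro ⟨b, ⟨p, hp, hpb, hb⟩, hab⟩
    refine IsSubStaircase.of_strictMono hp (fun t => (hab _).trans (hpb t).le) fun i => ?_
    by_cases h : ∃ t, p t = i
    · obtain ⟨t, rfl⟩ := h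
      exact ((hab _).trans (hpb t).le).trans_lt t.2
    · have := hb i (not_exists.1 h)
      have := hab i
      omega
  · intro h
    obtain ⟨p, hp, hpa, ha⟩ := h.exists_strictMono
    classical
    refine ⟨fun i => if h : ∃ t, p t = i then (h.choose : ℕ) else k - 1,
      ⟨p, hp, fun t => ?_, fun i hi => ?_⟩, fun i => ?_⟩
    · have h : ∃ t', p t' = p t := ⟨t, rfl⟩
      simp only [dif_pos h]
      rw [hp.injective h.choose_spec]
    · exact dif_neg (not_exists.2 hi)
    · dsimp only
      split_ifs with h
      · have := hpa h.choose
        rwa [h.choose_spec] at this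
      · have := ha i
        omega

theorem card_subtype_fin_succ_eq_sum {k n : ℕ} (P : (Fin (n + 1) → Fin k) → Prop) :
    Nat.card {f // P f} =
      ∑ v : Fin k, Nat.card {g : Fin n → Fin k // P (Fin.snoc g v : Fin (n + 1) → Fin k)} := by
  rw [← Nat.card_sigma]
  symm
  refine Nat.card_congr (Equiv.ofBijective (fun x => ⟨Fin.snoc x.2.1 x.1, x.2.2⟩) ⟨?_, ?_⟩)
  · rintro ⟨v, g, hg⟩ ⟨v', g', hg'⟩ h
    have h := congrArg Subtype.val h
    obtain ⟨rfl, rfl⟩ := Fin.snoc_injective2 (α := fun _ => Fin k) h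
    rfl
  · rintro ⟨f, hf⟩
    refine ⟨⟨f (Fin.last n), Fin.init f, ?_⟩, Subtype.ext (Fin.snoc_init_self f)⟩
    rwa [Fin.snoc_init_self f]

theorem card_subset_image_eq (k n : ℕ) (T : Finset (Fin k)) :
    Nat.card {f : Fin n → Fin k // ∀ v ∈ T, ∃ i, f i = v} =
      Nat.card {a : Fin n → Fin k // IsSubStaircase k n T.card fun i => a i} := by
  induction n generalizing T with
  | zero =>
    refine Nat.card_congr (Equiv.subtypeEquivRight fun f => ?_)
    simp [IsSubStaircase, Finset.eq_empty_iff_forall_notMem]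
  | succ n ih =>
    rw [card_subtype_fin_succ_eq_sum fun f : Fin (n + 1) → Fin k => ∀ v ∈ T, ∃ i, f i = v,
      card_subtype_fin_succ_eq_sum fun a : Fin (n + 1) → Fin k =>
        IsSubStaircase k (n + 1) T.card fun i => a i]
    let g : ℕ → ℕ := fun s => Nat.card {a : Fin n → Fin k // IsSubStaircase k n s fun i => a i}
    have h1 (v : Fin k) : Nat.card {f : Fin n → Fin k //
        ∀ w ∈ T, ∃ i, (Fin.snoc f v : Fin (n + 1) → Fin k) i = w} =
          if v ∈ T then g (T.card - 1) else g T.card := by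
      have : (if v ∈ T then g (T.card - 1) else g T.card) = g (T.erase v).card := by
        rw [Finset.card_erase_eq_ite]
        split_ifs <;> rfl
      rw [this]
      refine Eq.trans ?_ (ih (T.erase v))
      refine Nat.card_congr (Equiv.subtypeEquivRight fun f => ?_)
      refine forall_congr' fun w => ?_
      simp only [Fin.exists_fin_succ', Fin.snoc_castSucc, Fin.snoc_last, Finset.mem_erase]
      grind
    have h2 (v : Fin k) : Nat.card {f : Fin n → Fin k //
        IsSubStaircase k (n + 1) T.card
          fun i => ((Fin.snoc f v : Fin (n + 1) → Fin k) i : ℕ)} =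
          if (v : ℕ) < T.card then g (T.card - 1) else g T.card := by
      have : (if (v : ℕ) < T.card then g (T.card - 1) else g T.card) =
          g (if (v : ℕ) < T.card then T.card - 1 else T.card) := by
        split_ifs <;> rfl
      rw [this]
      refine Nat.card_congr (Equiv.subtypeEquivRight fun f => ?_)
      simp [IsSubStaircase]
    rw [Finset.sum_congr rfl fun v _ => h1 v, Finset.sum_congr rfl fun v _ => h2 v]
    have hT : T.card ≤ k := by simpa using T.card_le_univ
    have h3 : (Finset.univ.filter fun v : Fin k => (v : ℕ) < T.card).card = T.card := by
      simp [Fin.card_filter_val_lt, hT]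
    have h4 : (Finset.univ.filter fun v : Fin k => ¬ (v : ℕ) < T.card).card =
        (Finset.univ.filter fun v : Fin k => v ∉ T).card := by
      have e1 := Finset.card_filter_add_card_filter_not (s := Finset.univ) fun v : Fin k => (v : ℕ) < T.card
      have e2 := Finset.card_filter_add_card_filter_not (s := Finset.univ) fun v : Fin k => v ∈ T
      have e3 : (Finset.univ.filter fun v : Fin k => v ∈ T).card = T.card := by simp
      omega
    simp only [Finset.sum_ite, Finset.sum_const, h3, h4]
    simp

section Spanning

universe u

variable {K R : Type*} [CommRing K] [CommRing R] [Algebra K R]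

/-- The monic polynomial whose multiset of roots is `T`. -/
noncomputable def rootPoly (T : Multiset K) : Polynomial K :=
  (T.map fun a => Polynomial.X - Polynomial.C a).prod

theorem rootPoly_cons (a : K) (T : Multiset K) :
    rootPoly (a ::ₘ T) = (Polynomial.X - Polynomial.C a) * rootPoly T := by
  simp [rootPoly]

theorem rootPoly_add (T U : Multiset K) : rootPoly (T + U) = rootPoly T * rootPoly U := by
  simp [rootPoly]

theorem monic_rootPoly (T : Multiset K) : (rootPoly T).Monic :=
  Polynomial.monic_multiset_prod_of_monic _ _ fun _ _ => Polynomial.monic_X_sub_C _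

theorem natDegree_rootPoly_le (T : Multiset K) : (rootPoly T).natDegree ≤ T.card := by
  induction T using Multiset.induction with
  | empty => simp [rootPoly]
  | cons a T ih =>
    rw [rootPoly_cons, Multiset.card_cons, add_comm]
    exact Polynomial.natDegree_mul_le_of_le (Polynomial.natDegree_X_sub_C_le _) ih

/-- The quotient of `R` by the elements `r` such that `q * r` is a multiple of `q * z`. -/
theorem exists_algHom_eq_zero_iff_dvd {R : Type u} [CommRing R] [Algebra K R] (q z : R) :
    ∃ (S : Type u) (_ : CommRing S) (_ : Algebra K S) (φ : R →ₐ[K] S),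
      Function.Surjective φ ∧ ∀ r, φ r = 0 ↔ q * z ∣ q * r := by
  let I : Ideal R := Submodule.comap (LinearMap.mulLeft R q) (Ideal.span {q * z})
  refine ⟨R ⧸ I, inferInstance, inferInstance, Ideal.Quotient.mkₐ K I,
    Ideal.Quotient.mkₐ_surjective K I, fun r => ?_⟩
  rw [Ideal.Quotient.mkₐ_eq_mk, Ideal.Quotient.eq_zero_iff_mem]
  simp [I, Ideal.mem_span_singleton]

variable {S : Type*} [CommRing S] [Algebra K S] (φ : R →ₐ[K] S)

theorem mul_mem_of_span_eq_top {ι : Type*} {q z : R}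
    (hφ : ∀ r, φ r = 0 ↔ q * z ∣ q * r) {m : ι → R} {M : Submodule K R}
    (hspan : Submodule.span K (Set.range fun i => φ (m i)) = ⊤)
    (hm : ∀ i, q * m i ∈ M) (hz : ∀ r, q * z * r ∈ M) (r : R) : q * r ∈ M := by
  have hr : φ r ∈ (Submodule.span K (Set.range m)).map φ.toLinearMap := by
    rw [Submodule.map_span, ← Set.range_comp]
    exact hspan ▸ Submodule.mem_top
  obtain ⟨r₀, hr₀, h⟩ := hr
  have h1 : φ (r - r₀) = 0 := by
    rw [map_sub, sub_eq_zero]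
    exact h.symm
  obtain ⟨r', hr'⟩ := (hφ _).1 h1
  have h2 : Submodule.span K (Set.range m) ≤ M.comap (LinearMap.mulLeft K q) := by
    rw [Submodule.span_le]
    rintro _ ⟨i, rfl⟩
    exact hm i
  have h3 : q * r = q * r₀ + q * z * r' := by rw [← hr']; ring
  rw [h3]
  exact M.add_mem (h2 hr₀) (hz r')

theorem adjoin_range_castSucc_eq_top {n : ℕ} {x : Fin (n + 1) → R} {a : K}
    (hφ : Function.Surjective φ) (hx : Algebra.adjoin K (Set.range x) = ⊤)
    (ha : φ (x (Fin.last n)) = algebraMap K S a) :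
    Algebra.adjoin K (Set.range fun i : Fin n => φ (x i.castSucc)) = ⊤ := by
  rw [eq_top_iff, ← (AlgHom.range_eq_top φ).2 hφ, ← Algebra.map_top, ← hx, AlgHom.map_adjoin,
    Algebra.adjoin_le_iff]
  rintro _ ⟨_, ⟨i, rfl⟩, rfl⟩
  induction i using Fin.lastCases with
  | cast i => exact Algebra.subset_adjoin ⟨i, rfl⟩
  | last =>
    rw [ha]
    exact Subalgebra.algebraMap_mem _ _

theorem map_map_algebraMap (p : Polynomial K) :
    (p.map (algebraMap K R)).map (φ : R →+* S) = p.map (algebraMap K S) := by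
  rw [Polynomial.map_map, AlgHom.comp_algebraMap]

theorem map_prod_X_sub_C {ι : Type*} [Fintype ι] (x : ι → R) :
    (∏ i, (Polynomial.X - Polynomial.C (x i))).map (φ : R →+* S) =
      ∏ i, (Polynomial.X - Polynomial.C (φ (x i))) := by
  simp [Polynomial.map_prod]

/-- If `p` divides `f * (X - y)`, then `p` divides `f` after multiplication by `p(y)`. -/
theorem exists_C_eval_mul_eq {p f : Polynomial R} {y : R}
    (h : p ∣ f * (Polynomial.X - Polynomial.C y)) :
    ∃ g, Polynomial.C (p.eval y) * f = Polynomial.C (p.eval y) * (p * g) := by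
  obtain ⟨g, hg⟩ := h
  obtain ⟨g', hg'⟩ := Polynomial.X_sub_C_dvd_sub_C_eval (a := y) (p := g)
  have h0 : p.eval y * g.eval y = 0 := by
    rw [← Polynomial.eval_mul, ← hg]
    simp
  have h1 : Polynomial.C (p.eval y) * Polynomial.C (g.eval y) = 0 := by
    rw [← Polynomial.C_mul, h0, Polynomial.C_0]
  refine ⟨g', (Polynomial.monic_X_sub_C y).isRegular.right ?_⟩
  dsimp only
  linear_combination Polynomial.C (p.eval y) * hg + Polynomial.C (p.eval y) * p * hg' + p * h1

theorem span_prod_pow_eq_top {n : ℕ} :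
    ∀ {R : Type u} [CommRing R] [Algebra K R] (x : Fin n → R) (T U : Multiset K),
      Algebra.adjoin K (Set.range x) = ⊤ →
      (∀ i, Polynomial.aeval (x i) (rootPoly (T + U)) = 0) →
      (rootPoly T).map (algebraMap K R) ∣ ∏ i, (Polynomial.X - Polynomial.C (x i)) →
      Submodule.span K (Set.range fun a : {a // IsSubStaircase (T.card + U.card) n T.card a} =>
        ∏ i, x i ^ a.1 i) = ⊤ := by
  induction n with
  | zero =>
    intro R _ _ x T U hx _ hdvd
    rcases Nat.eq_zero_or_pos T.card with hT | hT
    · have h1 : (1 : R) ∈ Submodule.span K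
          (Set.range fun a : {a // IsSubStaircase (T.card + U.card) 0 T.card a} =>
            ∏ i, x i ^ a.1 i) :=
        Submodule.subset_span ⟨⟨Fin.elim0, hT⟩, by simp⟩
      rw [Set.range_eq_empty x, Algebra.adjoin_empty] at hx
      rw [eq_top_iff]
      intro r _
      obtain ⟨c, rfl⟩ := Algebra.mem_bot.1 (hx ▸ Algebra.mem_top : r ∈ (⊥ : Subalgebra K R))
      rw [Algebra.algebraMap_eq_smul_one]
      exact Submodule.smul_mem _ _ h1
    · have hsub : Subsingleton R := by
        by_contra hne
        rw [not_subsingleton_iff_nontrivial] at hne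
        have hK : Nontrivial K := (algebraMap K R).domain_nontrivial
        have hd := congrArg Polynomial.natDegree
          (((monic_rootPoly T).map (algebraMap K R)).eq_one_of_isUnit
            (isUnit_of_dvd_one (by simpa using hdvd)))
        rw [(monic_rootPoly T).natDegree_map, rootPoly,
          Polynomial.natDegree_multiset_prod_X_sub_C_eq_card,
          Polynomial.natDegree_one] at hd
        omega
      exact Subsingleton.elim _ _
  | succ n ih =>
    intro R _ _ x T U hx hroot hdvd
    set y := x (Fin.last n) with hy
    rw [Fin.prod_univ_castSucc, ← hy] at hdvd
    set M := Submodule.span K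
      (Set.range fun a : {a // IsSubStaircase (T.card + U.card) (n + 1) T.card a} =>
        ∏ i, x i ^ a.1 i) with hM
    -- multiplying an admissible monomial by a polynomial in the last variable
    have hmono {Q : Polynomial K} {j : ℕ} (hQ : Q.natDegree ≤ j) {m : Fin n → ℕ}
        (hm : ∀ i ≤ j, IsSubStaircase (T.card + U.card) (n + 1) T.card
          (Fin.snoc m i : Fin (n + 1) → ℕ)) :
        Polynomial.aeval y Q * ∏ i, x i.castSucc ^ m i ∈ M := by
      rw [Polynomial.aeval_eq_sum_range' (Nat.lt_succ_of_le hQ), Finset.sum_mul]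
      refine M.sum_mem fun i hi => ?_
      rw [smul_mul_assoc]
      refine M.smul_mem _ (Submodule.subset_span
        ⟨⟨_, hm i (Nat.lt_succ_iff.1 (Finset.mem_range.1 hi))⟩, ?_⟩)
      simp [Fin.prod_univ_castSucc, hy, mul_comm]
    have hroot' {S : Type u} [CommRing S] [Algebra K S] (φ : R →ₐ[K] S) (W : Multiset K)
        (hW : W = T + U) (i : Fin n) : Polynomial.aeval (φ (x i.castSucc)) (rootPoly W) = 0 := by
      rw [hW, Polynomial.aeval_algHom_apply, hroot, map_zero]
    have hlast {S : Type u} [CommRing S] [Algebra K S] {φ : R →ₐ[K] S} {q : R} {a : K}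
        (hφ : ∀ r, φ r = 0 ↔ q * (y - algebraMap K R a) ∣ q * r) :
        φ (x (Fin.last n)) = algebraMap K S a := by
      rw [← sub_eq_zero, ← φ.commutes a, ← map_sub]
      exact (hφ _).2 (dvd_refl _)
    have step1 (U₂ : Multiset K) : ∀ U₁, U = U₁ + U₂ → ∀ r,
        Polynomial.aeval y (rootPoly (T + U₁)) * r ∈ M := by
      induction U₂ using Multiset.induction with
      | empty =>
        rintro U₁ rfl r
        rw [add_zero] at hroot
        rw [hroot, zero_mul]
        exact M.zero_mem
      | cons a U₂ ih₂ =>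
        intro U₁ hU r
        have hU' : U = (a ::ₘ U₁) + U₂ := by rw [hU, Multiset.add_cons, Multiset.cons_add]
        set q := Polynomial.aeval y (rootPoly (T + U₁)) with hq
        obtain ⟨S, _, _, φ, hsurj, hφ⟩ :=
          exists_algHom_eq_zero_iff_dvd (K := K) q (y - algebraMap K R a)
        have hspan := ih (fun i => φ (x i.castSucc)) T U
          (adjoin_range_castSucc_eq_top φ hsurj hx (hlast hφ)) (hroot' φ _ rfl) ?_
        · simp only [← map_pow, ← map_prod] at hspan
          refine mul_mem_of_span_eq_top φ hφ hspan ?_ ?_ r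
          · rintro ⟨m, hm⟩
            refine hmono (natDegree_rootPoly_le _) fun i hi => IsSubStaircase.snoc ?_ ?_
            · have := congrArg Multiset.card hU
              simp only [Multiset.card_add, Multiset.card_cons] at this hi
              omega
            · split_ifs
              · exact hm.pred
              · exact hm
          · intro r
            have := ih₂ (a ::ₘ U₁) hU' r
            rwa [Multiset.add_cons, rootPoly_cons, map_mul, mul_comm (Polynomial.aeval y _), map_sub,
              Polynomial.aeval_X, Polynomial.aeval_C] at this
        · obtain ⟨g, hg⟩ := exists_C_eval_mul_eq hdvd
          rw [← map_prod_X_sub_C φ, ← map_map_algebraMap φ]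
          refine ⟨g.map φ, ?_⟩
          rw [← Polynomial.map_mul]
          ext i
          rw [Polynomial.coeff_map, Polynomial.coeff_map, ← sub_eq_zero, ← map_sub]
          refine (hφ _).2 ?_
          have h1 := congrArg (fun f => Polynomial.coeff f i) hg
          simp only [Polynomial.coeff_C_mul, Polynomial.eval_map_algebraMap] at h1
          have h2 : q = Polynomial.aeval y (rootPoly U₁) * Polynomial.aeval y (rootPoly T) := by
            rw [hq, rootPoly_add, map_mul, mul_comm]
          have h3 (A B : R) (h : Polynomial.aeval y (rootPoly T) * A =
              Polynomial.aeval y (rootPoly T) * B) : q * (A - B) = 0 := by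
            rw [h2]
            linear_combination Polynomial.aeval y (rootPoly U₁) * h
          rw [h3 _ _ h1]
          exact dvd_zero _
    have step2 (T₂ : Multiset K) : ∀ T₁, T = T₁ + T₂ → ∀ r,
        Polynomial.aeval y (rootPoly T₁) * r ∈ M := by
      induction T₂ using Multiset.induction with
      | empty =>
        rintro T₁ rfl r
        simpa using step1 U 0 (zero_add U).symm r
      | cons a T₂ ih₂ =>
        intro T₁ hT r
        have hT' : T = (a ::ₘ T₁) + T₂ := by rw [hT, Multiset.add_cons, Multiset.cons_add]
        have hT₂ : T = a ::ₘ (T₁ + T₂) := by rw [hT, Multiset.add_cons]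
        have hcard : T.card = (T₁ + T₂).card + 1 := by rw [hT₂, Multiset.card_cons]
        set q := Polynomial.aeval y (rootPoly T₁) with hq
        obtain ⟨S, _, _, φ, hsurj, hφ⟩ :=
          exists_algHom_eq_zero_iff_dvd (K := K) q (y - algebraMap K R a)
        have hspan := ih (fun i => φ (x i.castSucc)) (T₁ + T₂) (a ::ₘ U)
          (adjoin_range_castSucc_eq_top φ hsurj hx (hlast hφ))
          (hroot' φ _ (by rw [hT₂, Multiset.add_cons, Multiset.cons_add])) ?_
        · simp only [← map_pow, ← map_prod] at hspan
          refine mul_mem_of_span_eq_top φ hφ hspan ?_ ?_ r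
          · rintro ⟨m, hm⟩
            have hm' : IsSubStaircase (T.card + U.card) n (T.card - 1) m := by
              convert hm using 1
              · rw [hcard, Multiset.card_cons]
                omega
              · omega
            refine hmono (natDegree_rootPoly_le _) fun i hi => IsSubStaircase.snoc ?_ ?_
            · rw [Multiset.card_add] at hcard
              omega
            · rw [if_pos]
              · exact hm'
              · rw [Multiset.card_add] at hcard
                omega
          · intro r
            have := ih₂ (a ::ₘ T₁) hT' r
            rwa [rootPoly_cons, map_mul, mul_comm (Polynomial.aeval y _), map_sub,
              Polynomial.aeval_X, Polynomial.aeval_C] at this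
        · have h1 := Polynomial.map_dvd (φ : R →+* S) hdvd
          have h2 : φ y = algebraMap K S a := hlast hφ
          rw [Polynomial.map_mul, map_prod_X_sub_C, map_map_algebraMap, hT₂, rootPoly_cons, Polynomial.map_mul, mul_comm,
            Polynomial.map_sub, Polynomial.map_sub, Polynomial.map_X, Polynomial.map_X,
            Polynomial.map_C, Polynomial.map_C, RingHom.coe_coe, h2] at h1
          obtain ⟨g, hg⟩ := h1
          refine ⟨g, (Polynomial.monic_X_sub_C (algebraMap K _ a)).isRegular.right ?_⟩
          dsimp only
          rw [hg]
          ring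
    rw [eq_top_iff]
    intro r _
    simpa [rootPoly] using step2 T 0 (zero_add T).symm r

theorem span_prod_pow_eq_top_of_card_eq {n k : ℕ} (x : Fin n → R) {T : Multiset K}
    (hT : T.card = k) (hx : Algebra.adjoin K (Set.range x) = ⊤)
    (hroot : ∀ i, Polynomial.aeval (x i) (rootPoly T) = 0)
    (hdvd : (rootPoly T).map (algebraMap K R) ∣ ∏ i, (Polynomial.X - Polynomial.C (x i))) :
    Submodule.span K (Set.range fun a : {a // IsSubStaircase k n k a} => ∏ i, x i ^ a.1 i) = ⊤ := by
  subst hT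
  exact span_prod_pow_eq_top x T 0 hx (by simpa using hroot) hdvd

end Spanning

section Evaluation

/-- A monic polynomial over `K` divides `f` over `R` as soon as it does so after applying
a jointly injective family of algebra homomorphisms to `K`. -/
theorem map_dvd_of_forall_dvd_map {K R ι : Type*} [CommRing K] [CommRing R] [Algebra K R]
    {p : Polynomial K} (hp : p.Monic) (φ : ι → R →ₐ[K] K)
    (hφ : ∀ r, (∀ i, φ i r = 0) → r = 0) {f : Polynomial R}
    (h : ∀ i, p ∣ f.map (φ i : R →+* K)) : p.map (algebraMap K R) ∣ f := by
  rw [← Polynomial.modByMonic_eq_zero_iff_dvd (hp.map _)]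
  ext j
  rw [Polynomial.coeff_zero]
  refine hφ _ fun i => ?_
  have h1 : (f %ₘ p.map (algebraMap K R)).map (φ i : R →+* K) = 0 := by
    rw [Polynomial.map_modByMonic _ (hp.map _), map_map_algebraMap, Algebra.algebraMap_self,
      Polynomial.map_id]
    exact (Polynomial.modByMonic_eq_zero_iff_dvd hp).2 (h i)
  have h2 := congrArg (fun g => Polynomial.coeff g j) h1
  simpa using h2

theorem rootPoly_map_dvd_prod {K : Type*} [CommRing K] {n k : ℕ} (α : Fin k → K)
    {f : Fin n → Fin k} (hf : Function.Surjective f) :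
    rootPoly (Finset.univ.val.map α) ∣
      ∏ i, (Polynomial.X - Polynomial.C (α (f i))) := by
  have h1 : rootPoly (Finset.univ.val.map α) =
      ∏ i ∈ Finset.univ.image (Function.surjInv hf),
        (Polynomial.X - Polynomial.C (α (f i))) := by
    rw [Finset.prod_image (Function.injective_surjInv hf).injOn, rootPoly, Multiset.map_map]
    simp only [Function.surjInv_eq hf]
    rfl
  rw [h1]
  exact Finset.prod_dvd_prod_of_subset _ _ _ (Finset.subset_univ _)

theorem eval_rootPoly_map {K : Type*} [CommRing K] {k : ℕ} (α : Fin k → K) (v : Fin k) :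
    (rootPoly (Finset.univ.val.map α)).eval (α v) = 0 := by
  rw [rootPoly, Multiset.map_map]
  change Polynomial.eval _ (∏ w, (Polynomial.X - Polynomial.C (α w))) = 0
  rw [Polynomial.eval_prod]
  exact Finset.prod_eq_zero (Finset.mem_univ v) (by simp)

open Classical in
theorem exists_eval_eq_sum {K : Type*} [CommRing K] {n k : ℕ} (α : Fin k → K)
    (h : MvPolynomial (Fin n) K) :
    ∃ c : {a : Fin n → Fin k // IsSubStaircase k n k fun i => a i} → K,
      ∀ f : Fin n → Fin k, Function.Surjective f →
        eval (fun i => α (f i)) h = ∑ a, c a * ∏ i, α (f i) ^ (a.1 i : ℕ) := by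
  let x : Fin n → {f : Fin n → Fin k // Function.Surjective f} → K := fun i f => α (f.1 i)
  let A := Algebra.adjoin K (Set.range x)
  let x' : Fin n → A := fun i => ⟨x i, Algebra.subset_adjoin ⟨i, rfl⟩⟩
  let φ : {f : Fin n → Fin k // Function.Surjective f} → A →ₐ[K] K := fun f =>
    (Pi.evalAlgHom K (fun _ => K) f).comp A.val
  have hφ (r : A) (hr : ∀ f, φ f r = 0) : r = 0 := Subtype.ext (funext hr)
  have hφx (f) (i) : φ f (x' i) = α (f.1 i) := rfl
  have htop : Algebra.adjoin K (Set.range x') = ⊤ := by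
    rw [← Algebra.adjoin_adjoin_coe_preimage (R := K) (s := Set.range x)]
    congr 1
    ext r
    simp only [Set.mem_range, Set.mem_preimage]
    exact exists_congr fun i => Subtype.ext_iff
  have hspan := span_prod_pow_eq_top_of_card_eq x' (T := Finset.univ.val.map α) (k := k) (by simp) htop ?_ ?_
  · have hr := hspan ▸ Submodule.mem_top (x := aeval x' h)
    have hr' : aeval x' h ∈ Submodule.span K (Set.range
        fun a : {a : Fin n → Fin k // IsSubStaircase k n k fun i => a i} =>
          ∏ i, x' i ^ (a.1 i : ℕ)) := by
      refine Submodule.span_mono ?_ hr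
      rintro _ ⟨⟨a, ha⟩, rfl⟩
      obtain ⟨-, -, -, hk⟩ := ha.exists_strictMono
      exact ⟨⟨fun i => ⟨a i, hk i⟩, ha⟩, rfl⟩
    obtain ⟨c, hc⟩ := (Submodule.mem_span_range_iff_exists_fun K).1 hr'
    refine ⟨c, fun f hf => ?_⟩
    have := congrArg (φ ⟨f, hf⟩) hc
    rw [comp_aeval_apply] at this
    simp only [map_sum, map_smul, map_prod, map_pow, hφx, smul_eq_mul] at this
    exact this.symm
  · intro i
    refine hφ _ fun f => ?_
    rw [← Polynomial.aeval_algHom_apply, hφx]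
    exact eval_rootPoly_map α _
  · refine map_dvd_of_forall_dvd_map (monic_rootPoly _) φ hφ fun f => ?_
    rw [map_prod_X_sub_C]
    exact rootPoly_map_dvd_prod α f.2

open Classical in
theorem eq_zero_of_forall_surjective_sum_eq_zero {K : Type*} [CommRing K] [IsDomain K] {n k : ℕ}
    {α : Fin k → K} (hα : Function.Injective α)
    (c : {a : Fin n → Fin k // IsSubStaircase k n k fun i => a i} → K)
    (h : ∀ f : Fin n → Fin k, Function.Surjective f →
      ∑ a, c a * ∏ i, α (f i) ^ (a.1 i : ℕ) = 0) (a) : c a = 0 := by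
  have hcard := card_subset_image_eq k n Finset.univ
  simp only [Finset.mem_univ, true_imp_iff, Finset.card_univ, Fintype.card_fin] at hcard
  let e : {f : Fin n → Fin k // Function.Surjective f} ≃
    {a : Fin n → Fin k // IsSubStaircase k n k fun i => a i} := (Finite.card_eq.1 hcard).some
  let M : Matrix {f : Fin n → Fin k // Function.Surjective f}
    {f : Fin n → Fin k // Function.Surjective f} K :=
    Matrix.of fun g f => ∏ i, α (f.1 i) ^ ((e g).1 i : ℕ)
  have hdelta (g : {f : Fin n → Fin k // Function.Surjective f}) : ∃ d : K, d ≠ 0 ∧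
      ∃ b : {f : Fin n → Fin k // Function.Surjective f} → K, ∀ f,
        ∑ g', b g' * M g' f = if g = f then d else 0 := by
    obtain ⟨b, hb⟩ := exists_eval_eq_sum α
      (∏ i, ∏ v ∈ Finset.univ.erase (g.1 i), (X i - C (α v)))
    refine ⟨∏ i, ∏ v ∈ Finset.univ.erase (g.1 i), (α (g.1 i) - α v), ?_, b ∘ e, fun f => ?_⟩
    · refine Finset.prod_ne_zero_iff.2 fun i _ => Finset.prod_ne_zero_iff.2 fun v hv => ?_
      rw [sub_ne_zero]
      exact fun h => Finset.ne_of_mem_erase hv (hα h).symm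
    · have h1 := hb f.1 f.2
      rw [← e.sum_comp] at h1
      refine h1.symm.trans ?_
      simp only [map_prod, map_sub, eval_X, eval_C]
      split_ifs with hgf
      · rw [hgf]
      · obtain ⟨i, hi⟩ : ∃ i, g.1 i ≠ f.1 i := by
          by_contra! hall
          exact hgf (Subtype.ext (funext hall))
        exact Finset.prod_eq_zero (Finset.mem_univ i) (Finset.prod_eq_zero
          (Finset.mem_erase.2 ⟨hi.symm, Finset.mem_univ (f.1 i)⟩) (sub_self _))
  choose d hd b hb using hdelta
  have hBM : Matrix.of b * M = Matrix.diagonal d := by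
    ext g f
    rw [Matrix.mul_apply, Matrix.diagonal_apply]
    exact hb g f
  have hdet : M.det ≠ 0 := by
    intro h0
    have h1 := congrArg Matrix.det hBM
    rw [Matrix.det_mul, h0, mul_zero, Matrix.det_diagonal] at h1
    exact Finset.prod_ne_zero_iff.2 (fun g _ => hd g) h1.symm
  have hzero : c ∘ e = 0 := by
    refine Matrix.eq_zero_of_vecMul_eq_zero hdet (funext fun f => ?_)
    have := h f.1 f.2
    rw [← e.sum_comp] at this
    exact this
  simpa using congrFun hzero (e.symm a)

end Evaluation

section Ink

theorem coeff_prod_X_sub_C {R : Type*} [CommRing R] [Algebra ℚ R] {n j : ℕ} (hj : j ≤ n)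
    (x : Fin n → R) : (∏ i, (Polynomial.X - Polynomial.C (x i))).coeff j =
      (-1) ^ (n - j) * aeval x (esymm (Fin n) ℚ (n - j)) := by
  have h := Multiset.prod_X_sub_C_coeff (Finset.univ.val.map x) (k := j) (by simpa using hj)
  rw [Multiset.map_map] at h
  rw [aeval_esymm_eq_multiset_esymm]
  simp only [Multiset.card_map, Finset.card_val, Finset.card_univ, Fintype.card_fin] at h
  exact h

theorem rootPoly_replicate_zero {K : Type*} [CommRing K] (k : ℕ) :
    rootPoly (Multiset.replicate k (0 : K)) = Polynomial.X ^ k := by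
  simp [rootPoly]

theorem esymm_mem_Ink {n k j : ℕ} (hkn : k ≤ n) (hj : j < k) :
    esymm (Fin n) ℚ (n - j) ∈ Ink n k :=
  Ideal.subset_span (Or.inr ⟨n - j, by omega, by omega, rfl⟩)

theorem span_quotient_Ink_eq_top {n k : ℕ} (hkn : k ≤ n) :
    Submodule.span ℚ (Set.range fun a : {a // IsSubStaircase k n k a} =>
      Ideal.Quotient.mk (Ink n k) (∏ i : Fin n, X i ^ a.1 i)) = ⊤ := by
  have h := span_prod_pow_eq_top_of_card_eq (K := ℚ)
    (fun i : Fin n => Ideal.Quotient.mkₐ ℚ (Ink n k) (X i)) (Multiset.card_replicate k 0) ?_ ?_ ?_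
  · simp only [← map_pow, ← map_prod] at h
    exact h
  · have h1 := Set.range_comp (Ideal.Quotient.mkₐ ℚ (Ink n k)) (X : Fin n → MvPolynomial (Fin n) ℚ)
    change Algebra.adjoin ℚ (Set.range (Ideal.Quotient.mkₐ ℚ (Ink n k) ∘ X)) = ⊤
    rw [h1, ← AlgHom.map_adjoin, adjoin_range_X, Algebra.map_top]
    exact (AlgHom.range_eq_top _).2 (Ideal.Quotient.mkₐ_surjective _ _)
  · intro i
    rw [rootPoly_replicate_zero, map_pow, Polynomial.aeval_X, ← map_pow]
    exact Ideal.Quotient.eq_zero_iff_mem.2 (Ideal.subset_span (Or.inl ⟨i, rfl⟩))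
  · rw [rootPoly_replicate_zero, Polynomial.map_pow, Polynomial.map_X, Polynomial.X_pow_dvd_iff]
    intro j hj
    rw [coeff_prod_X_sub_C (hj.le.trans hkn), ← comp_aeval_apply, aeval_X_left, AlgHom.id_apply]
    have : Ideal.Quotient.mkₐ ℚ (Ink n k) (esymm (Fin n) ℚ (n - j)) = 0 :=
      Ideal.Quotient.eq_zero_iff_mem.2 (esymm_mem_Ink hkn hj)
    rw [this, mul_zero]

/-- Every polynomial in `Ink n k` is the specialization at `t = 0` of a polynomial over `ℚ[t]`
vanishing at all points `(t * f 1, …, t * f n)` with `f` surjective. -/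
theorem exists_map_eq_of_mem_Ink {n k : ℕ} {p : MvPolynomial (Fin n) ℚ} (hp : p ∈ Ink n k) :
    ∃ q : MvPolynomial (Fin n) (Polynomial ℚ), map (Polynomial.evalRingHom 0) q = p ∧
      ∀ f : Fin n → Fin k, Function.Surjective f →
        eval (fun i => (Polynomial.C ((f i : ℕ) : ℚ) * Polynomial.X)) q = 0 := by
  let α : Fin k → Polynomial ℚ := fun v => Polynomial.C ((v : ℕ) : ℚ) * Polynomial.X
  let P := rootPoly (Finset.univ.val.map α)
  let I : Ideal (MvPolynomial (Fin n) (Polynomial ℚ)) :=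
    ⨅ f : {f : Fin n → Fin k // Function.Surjective f}, RingHom.ker (eval fun i => α (f.1 i))
  have hI (q) : q ∈ I ↔ ∀ f : Fin n → Fin k, Function.Surjective f →
      eval (fun i => α (f i)) q = 0 := by
    simp [I, RingHom.mem_ker]
  let φ : MvPolynomial (Fin n) (Polynomial ℚ) →+* MvPolynomial (Fin n) ℚ :=
    map (Polynomial.evalRingHom 0)
  have hφ : Function.Surjective φ :=
    map_surjective _ fun c => ⟨Polynomial.C c, by simp⟩
  suffices hle : Ink n k ≤ I.map φ by
    obtain ⟨q, hq, rfl⟩ := (Ideal.mem_map_iff_of_surjective φ hφ).1 (hle hp)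
    exact ⟨q, rfl, (hI q).1 hq⟩
  have hP : P.map (Polynomial.evalRingHom 0) = Polynomial.X ^ k := by
    simp only [P, rootPoly, Multiset.map_map]
    change Polynomial.map _ (∏ w, (Polynomial.X - Polynomial.C (α w))) = _
    simp [Polynomial.map_prod, α]
  rw [Ink, Ideal.span_le]
  rintro _ (⟨i, rfl⟩ | ⟨d, hd, hdn, rfl⟩)
  · refine (Ideal.mem_map_iff_of_surjective φ hφ).2 ⟨Polynomial.aeval (X i) P, ?_, ?_⟩
    · rw [hI]
      intro f _
      rw [← aeval_eq_eval, ← Polynomial.aeval_algHom_apply, aeval_X]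
      exact eval_rootPoly_map α _
    · rw [Polynomial.aeval_def, Polynomial.hom_eval₂]
      have h1 : φ.comp (algebraMap (Polynomial ℚ) (MvPolynomial (Fin n) (Polynomial ℚ))) =
          C.comp (Polynomial.evalRingHom 0) := by
        ext <;> simp [φ, algebraMap_eq]
      rw [h1, ← Polynomial.eval₂_map, hP]
      simp [φ]
  · have hPm : (P.map (C : Polynomial ℚ →+* MvPolynomial (Fin n) (Polynomial ℚ))).Monic :=
      (monic_rootPoly _).map _
    let F : Polynomial (MvPolynomial (Fin n) (Polynomial ℚ)) :=
      ∏ i, (Polynomial.X - Polynomial.C (X i))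
    have hrem (j : ℕ) : (F %ₘ P.map C).coeff j ∈ I := by
      rw [hI]
      intro f hf
      have h1 : (F %ₘ P.map C).map (eval fun i => α (f i)) = 0 := by
        rw [Polynomial.map_modByMonic _ hPm, Polynomial.map_map]
        have h2 : (eval fun i => α (f i)).comp C = RingHom.id (Polynomial ℚ) := by
          ext <;> simp
        rw [h2, Polynomial.map_id, Polynomial.modByMonic_eq_zero_iff_dvd (monic_rootPoly _)]
        simpa [F, Polynomial.map_prod] using rootPoly_map_dvd_prod α hf
      simpa using congrArg (fun g => Polynomial.coeff g j) h1
    have h3 : (F %ₘ P.map C).map φ =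
        (∏ i, (Polynomial.X - Polynomial.C (X i : MvPolynomial (Fin n) ℚ))) %ₘ
          Polynomial.X ^ k := by
      rw [Polynomial.map_modByMonic _ hPm, Polynomial.map_map]
      have h1 : φ.comp C = C.comp (Polynomial.evalRingHom 0) := by
        ext <;> simp [φ]
      rw [h1, ← Polynomial.map_map, hP]
      simp [F, Polynomial.map_prod, φ]
    have h4 := Ideal.mem_map_of_mem φ (hrem (n - d))
    rw [← Polynomial.coeff_map, h3] at h4
    have h5 := congrArg (fun g => Polynomial.coeff g (n - d)) (Polynomial.modByMonic_add_div
      (∏ i, (Polynomial.X - Polynomial.C (X i : MvPolynomial (Fin n) ℚ))) (Polynomial.X ^ k))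
    have h6 : ¬ k ≤ n - d := by omega
    simp only [Polynomial.coeff_add, Polynomial.coeff_X_pow_mul', if_neg h6, add_zero] at h5
    rw [h5, coeff_prod_X_sub_C (Nat.sub_le _ _), aeval_X_left, AlgHom.id_apply,
      Nat.sub_sub_self hdn] at h4
    have h7 := Ideal.mul_mem_left _ ((-1) ^ d) h4
    rwa [← mul_assoc, ← mul_pow, neg_one_mul, neg_neg, one_pow, one_mul] at h7

theorem linearIndependent_quotient_Ink (n k : ℕ) :
    LinearIndependent ℚ (fun a : {a : Fin n → Fin k // IsSubStaircase k n k fun i => a i} =>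
      Ideal.Quotient.mk (Ink n k) (∏ i : Fin n, X i ^ (a.1 i : ℕ))) := by
  classical
  rw [Fintype.linearIndependent_iff]
  intro c hc a
  have hmem : ∑ a, C (c a) * ∏ i : Fin n, X i ^ (a.1 i : ℕ) ∈ Ink n k := by
    rw [← Ideal.Quotient.eq_zero_iff_mem, map_sum, ← hc]
    refine Finset.sum_congr rfl fun a _ => ?_
    rw [← smul_eq_C_mul]
    exact map_smul (Ideal.Quotient.mkₐ ℚ (Ink n k)) _ _
  obtain ⟨q, hq, hq0⟩ := exists_map_eq_of_mem_Ink hmem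
  have hker : q - ∑ a, C (Polynomial.C (c a)) * ∏ i : Fin n, X i ^ (a.1 i : ℕ) ∈
      RingHom.ker (map (σ := Fin n) (Polynomial.evalRingHom (0 : ℚ))) := by
    rw [RingHom.mem_ker, map_sub, hq, sub_eq_zero]
    simp
  obtain ⟨h, hh⟩ : C Polynomial.X ∣
      q - ∑ a, C (Polynomial.C (c a)) * ∏ i : Fin n, X i ^ (a.1 i : ℕ) := by
    rw [C_dvd_iff_dvd_coeff]
    intro m
    rw [Polynomial.X_dvd_iff, Polynomial.coeff_zero_eq_eval_zero]
    have := congrArg (coeff m) hker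
    rwa [coeff_map, coeff_zero] at this
  let α : Fin k → Polynomial ℚ := fun v => Polynomial.C ((v : ℕ) : ℚ) * Polynomial.X
  have hα : Function.Injective α := by
    intro v w hvw
    have := mul_right_cancel₀ Polynomial.X_ne_zero hvw
    exact Fin.ext (by exact_mod_cast Polynomial.C_injective this)
  obtain ⟨d, hd⟩ := exists_eval_eq_sum α h
  have hzero := eq_zero_of_forall_surjective_sum_eq_zero hα
    (fun a => Polynomial.C (c a) + Polynomial.X * d a) (fun f hf => ?_) a
  · simpa using congrArg (Polynomial.eval 0) hzero
  · have h1 := congrArg (eval fun i => α (f i)) hh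
    rw [map_sub, hq0 f hf, map_mul, hd f hf] at h1
    simp only [map_sum, map_mul, map_prod, map_pow, eval_C, eval_X] at h1
    simp only [add_mul, Finset.sum_add_distrib, mul_assoc, ← Finset.mul_sum]
    linear_combination -h1

end Ink

/-- The images in `R_{n,k}` of the `(n,k)`-Artin monomials form a `ℚ`-vector space basis:
the family is linearly independent and spans. -/
theorem stmt11 (n k : ℕ) (hk : 1 ≤ k) (hkn : k ≤ n) :
    LinearIndependent ℚ (fun a : ArtinExp n k =>
      Ideal.Quotient.mk (Ink n k) (∏ i : Fin n, X i ^ a.1 i)) ∧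
    Submodule.span ℚ (Set.range fun a : ArtinExp n k =>
      Ideal.Quotient.mk (Ink n k) (∏ i : Fin n, X i ^ a.1 i)) = ⊤ := by
  classical
  constructor
  · have hbound (a : ArtinExp n k) (i : Fin n) : a.1 i < k := by
      obtain ⟨-, -, -, h⟩ := ((exists_isStaircase_iff hk a.1).1 a.2).exists_strictMono
      exact h i
    let e : ArtinExp n k → {a : Fin n → Fin k // IsSubStaircase k n k fun i => a i} := fun a =>
      ⟨fun i => ⟨a.1 i, hbound a i⟩, (exists_isStaircase_iff hk a.1).1 a.2⟩
    have he : Function.Injective e := fun a b hab => Subtype.ext <| funext fun i =>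
      congrArg Fin.val (congrFun (congrArg Subtype.val hab) i)
    exact (linearIndependent_quotient_Ink n k).comp e he
  · rw [← span_quotient_Ink_eq_top hkn]
    congr 1
    ext r
    constructor
    · rintro ⟨a, rfl⟩
      exact ⟨⟨a.1, (exists_isStaircase_iff hk a.1).1 a.2⟩, rfl⟩
    · rintro ⟨a, rfl⟩
      exact ⟨⟨a.1, (exists_isStaircase_iff hk a.1).2 a.2⟩, rfl⟩
end
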